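/- arXiv:1710.02727 — 5 statements merged into one kernel-verified Lean document; each statement's English description precedes it below -/
import Mathlib

section
/- Let 𝒢 be a minor-closed class of finite graphs of bounded treewidth, and let t ≥ 1 be an integer. Then the following are equivalent: (i) there exists an integer m ≥ 1 such that K_{t,m} ∉ 𝒢 and I_{t-1}+P_m ∉ 𝒢; (ii) there exists an integer C ≥ 1 such that every non-empty graph in 𝒢 contains a t-island of size at most C; (iii) there exists ε > 0 such that every graph G ∈ 𝒢 contains at least ε·|V(G)| pairwise disjoint t-islands; (iv) there exists ε > 0 such that every non-null graph in 𝒢 is ε-resistant to t-percolation. Consequently pcol_⋆(𝒢) = p(𝒢) = col_⋆(𝒢) equals the smallest t for which (i) holds. -/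
open SimpleGraph

/-- `S` is a `t`-island in `G`: a nonempty set of vertices each of which has
fewer than `t` neighbors outside `S`. -/
def IsIsland {V : Type*} (G : SimpleGraph V) (t : ℕ) (S : Set V) : Prop :=
  S.Nonempty ∧ ∀ v ∈ S, ((G.neighborSet v) \ S).ncard < t

/-- `H` is a minor of `G`: there is a model of `H` in `G`. -/
def IsMinorOf {W V : Type*} (H : SimpleGraph W) (G : SimpleGraph V) : Prop :=
  ∃ μ : W → Set V,
    (∀ w, (μ w).Nonempty) ∧
    (∀ w, (G.induce (μ w)).Connected) ∧
    (Pairwise fun w₁ w₂ => Disjoint (μ w₁) (μ w₂)) ∧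
    (∀ ⦃w₁ w₂⦄, H.Adj w₁ w₂ → ∃ u ∈ μ w₁, ∃ v ∈ μ w₂, G.Adj u v)

/-- The graph `I_n + P_m`: a path on `m` vertices together with `n` additional
pairwise non-adjacent vertices, each adjacent to every vertex of the path. -/
def IplusP (n m : ℕ) : SimpleGraph (Fin n ⊕ Fin m) :=
  SimpleGraph.fromRel (fun a b =>
    (∃ i j, a = Sum.inl i ∧ b = Sum.inr j) ∨
    (∃ i j : Fin m, a = Sum.inr i ∧ b = Sum.inr j ∧ (i : ℕ) + 1 = (j : ℕ)))

/-- `c` is a coloring of `G` with clustering `C`: every monochromatic connected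
subgraph has at most `C` vertices. -/
def ClusteredColoring {V α : Type*} (G : SimpleGraph V) (C : ℕ) (c : V → α) : Prop :=
  ∀ S : Set V, (G.induce S).Connected → (∀ u ∈ S, ∀ v ∈ S, c u = c v) → S.ncard ≤ C

/-- `G` has a tree decomposition of width at most `w`. -/
def HasTreewidthAtMost {V : Type*} (G : SimpleGraph V) (w : ℕ) : Prop :=
  ∃ (n : ℕ) (T : SimpleGraph (Fin n)) (β : Fin n → Set V), T.IsTree ∧
    (∀ ⦃u v⦄, G.Adj u v → ∃ x, u ∈ β x ∧ v ∈ β x) ∧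
    (∀ v : V, (T.induce {x | v ∈ β x}).Connected) ∧
    (∀ x, (β x).ncard ≤ w + 1)

/-- A class of graphs, given for each `n` as a collection of graphs on `Fin n`. -/
def MemClass (𝒢 : ∀ n : ℕ, SimpleGraph (Fin n) → Prop) {V : Type*} (G : SimpleGraph V) : Prop :=
  ∃ (n : ℕ) (G' : SimpleGraph (Fin n)), 𝒢 n G' ∧ Nonempty (G ≃g G')

/-- `𝒢` is a (proper) minor-closed class. -/
def MinorClosed (𝒢 : ∀ n : ℕ, SimpleGraph (Fin n) → Prop) : Prop :=
  (∃ (n : ℕ) (G : SimpleGraph (Fin n)), ¬ 𝒢 n G) ∧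
  ∀ ⦃n k : ℕ⦄ (G : SimpleGraph (Fin n)) (H : SimpleGraph (Fin k)),
    𝒢 n G → IsMinorOf H G → 𝒢 k H

/-- `𝒢` is closed under taking subgraphs (up to isomorphism). -/
def SubgraphClosed (𝒢 : ∀ n : ℕ, SimpleGraph (Fin n) → Prop) : Prop :=
  ∀ ⦃n k : ℕ⦄ (G : SimpleGraph (Fin n)) (H : SimpleGraph (Fin k)), 𝒢 n G →
    (∃ f : Fin k → Fin n, Function.Injective f ∧ ∀ ⦃a b⦄, H.Adj a b → G.Adj (f a) (f b)) →
    𝒢 k H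

/-- The vertices that eventually become active in bootstrap `t`-percolation
starting from the active set `A`. -/
inductive PercolationActive {V : Type*} (G : SimpleGraph V) (t : ℕ) (A : Set V) : V → Prop
  | base (v : V) : v ∈ A → PercolationActive G t A v
  | step (v : V) (N : Finset V) : t ≤ N.card → (∀ u ∈ N, G.Adj v u) →
      (∀ u ∈ N, PercolationActive G t A u) → PercolationActive G t A v

/-- The set `A` `t`-percolates in `G`. -/
def Percolates {V : Type*} (G : SimpleGraph V) (t : ℕ) (A : Set V) : Prop :=
  ∀ v, PercolationActive G t A v

/-- `G` contains `k` pairwise disjoint `t`-islands. -/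
def HasDisjointIslands {V : Type*} (G : SimpleGraph V) (t k : ℕ) : Prop :=
  ∃ f : Fin k → Set V, (∀ i, IsIsland G t (f i)) ∧ Pairwise (Function.onFun Disjoint f)

/-- `f` is significantly sublinear: `∑ f(⌈(3/2)^i⌉)/(3/2)^i` is finite. -/
def SignificantlySublinear (f : ℕ → ℕ) : Prop :=
  Summable (fun i : ℕ => (f ⌈((3:ℝ)/2)^i⌉₊ : ℝ) / ((3:ℝ)/2)^i)

/-- The class `𝒢` has `f`-separators. -/
def HasSeparators (f : ℕ → ℕ) (𝒢 : ∀ n : ℕ, SimpleGraph (Fin n) → Prop) : Prop :=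
  ∀ (n : ℕ) (G : SimpleGraph (Fin n)), 𝒢 n G →
    ∃ L R : G.Subgraph, L ⊔ R = ⊤ ∧ (L.verts ∩ R.verts).ncard ≤ f n ∧
      3 * (L.verts \ R.verts).ncard ≤ 2 * n ∧ 3 * (R.verts \ L.verts).ncard ≤ 2 * n

/-- The number of edges of `G` with at least one end in `A`. -/
noncomputable def edgesTouching {V : Type*} (G : SimpleGraph V) (A : Set V) : ℕ :=
  {e ∈ G.edgeSet | ∃ v ∈ A, v ∈ e}.ncard

/-- The vertices outside `D` with a neighbor in `D`. -/
def outerBoundary {V : Type*} (G : SimpleGraph V) (D : Set V) : Set V :=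
  {u | u ∉ D ∧ ∃ v ∈ D, G.Adj v u}

/-- The spanning subgraph of `G` whose edges are those of `G` with both ends in `R`. -/
def restrictTo {V : Type*} (G : SimpleGraph V) (R : Set V) : SimpleGraph V where
  Adj u v := G.Adj u v ∧ u ∈ R ∧ v ∈ R
  symm := ⟨fun _ _ h => ⟨h.1.symm, h.2.2, h.2.1⟩⟩
  loopless := ⟨fun _ h => G.loopless.irrefl _ h.1⟩

theorem restrictTo_le {V : Type*} (G : SimpleGraph V) (R : Set V) : restrictTo G R ≤ G :=
  fun _ _ h => h.1

theorem connected_singleton {V : Type*} (G : SimpleGraph V) (v : V) :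
    (G.induce {v}).Connected := by
  have : Nonempty ({v} : Set V) := ⟨⟨v, rfl⟩⟩
  exact ⟨fun x y => by
    have : x = y := Subsingleton.elim _ _
    subst this; exact Reachable.refl _⟩

theorem connected_induce_of_le {V : Type*} {G H : SimpleGraph V} (h : H ≤ G) {P : Set V}
    (hP : (H.induce P).Connected) : (G.induce P).Connected :=
  hP.mono (fun _ _ hab => h hab)

theorem subset_of_connected_restrictTo {V : Type*} {G : SimpleGraph V} {R P : Set V}
    (hP : ((restrictTo G R).induce P).Connected) (hne : (P ∩ R).Nonempty) : P ⊆ R := by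
  obtain ⟨a, haP, haR⟩ := hne
  intro u hu
  obtain ⟨p⟩ := hP.preconnected ⟨a, haP⟩ ⟨u, hu⟩
  have key : ∀ x y : P, ((restrictTo G R).induce P).Walk x y → (x : V) ∈ R → (y : V) ∈ R := by
    intro x y p
    induction p with
    | nil => exact id
    | cons h _ ih => exact fun _ => ih h.2.2
  exact key _ _ p haR

/-- In a connected set, one can reach a neighbor of `b` from `a` without using `b`. -/
theorem exists_connected_adj {V : Type*} {G : SimpleGraph V} {P : Set V}
    (hP : (G.induce P).Connected) {a b : V} (ha : a ∈ P) (hb : b ∈ P) (hab : a ≠ b) :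
    ∃ F ⊆ P \ {b}, a ∈ F ∧ (G.induce F).Connected ∧ ∃ u ∈ F, G.Adj u b := by
  have key : ∀ x y : P, (G.induce P).Walk x y → (x : V) ≠ y →
      ∃ F ⊆ P \ {(y : V)}, (x : V) ∈ F ∧ (G.induce F).Connected ∧ ∃ u ∈ F, G.Adj u y := by
    intro x y p
    induction p with
    | nil => exact fun h => absurd rfl h
    | @cons x c y h q ih =>
      intro hxy
      by_cases hcy : (c : V) = y
      · refine ⟨{(x : V)}, ?_, rfl, connected_singleton G _, x, rfl, ?_⟩
        · rintro _ rfl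
          exact ⟨x.2, hxy⟩
        · rw [← hcy]; exact h
      · obtain ⟨F, hF, hcF, hFc, u, hu, huy⟩ := ih hcy
        refine ⟨{(x : V)} ∪ F, ?_, Or.inl rfl, ?_, u, Or.inr hu, huy⟩
        · rintro z (rfl | hz)
          · exact ⟨x.2, hxy⟩
          · exact hF hz
        · exact connected_induce_union (connected_singleton G _).preconnected hFc.preconnected
            rfl hcF h
  obtain ⟨p⟩ := hP.preconnected ⟨a, ha⟩ ⟨b, hb⟩
  exact key _ _ p hab

/-- Pairwise disjoint sets, each of which meets a set `A` with as many elements as there are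
sets, meet `A` in one element each, and every element of `A` is covered. -/
theorem exists_bijOn_inter {V : Type*} [Finite V] {T A : Set V} {P : V → Set V}
    (hcard : A.ncard = T.ncard) (hmeet : ∀ b ∈ T, (P b ∩ A).Nonempty)
    (hdisj : ∀ b ∈ T, ∀ b' ∈ T, b ≠ b' → Disjoint (P b) (P b')) :
    ∃ g : V → V, Set.BijOn g T A ∧ ∀ b ∈ T, P b ∩ A = {g b} := by
  classical
  choose! g hg using hmeet
  have hinj : Set.InjOn g T := by
    intro b hb b' hb' h
    by_contra hne
    exact Set.disjoint_left.1 (hdisj b hb b' hb' hne) (hg b hb).1 (h ▸ (hg b' hb').1)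
  have himg : g '' T = A := by
    apply Set.eq_of_subset_of_ncard_le
    · rintro _ ⟨b, hb, rfl⟩
      exact (hg b hb).2
    · rw [hinj.ncard_image, hcard]
    · exact Set.toFinite _
  refine ⟨g, ⟨fun b hb => (hg b hb).2, hinj, himg.ge⟩, fun b hb => ?_⟩
  ext z
  constructor
  · rintro ⟨hz, hzA⟩
    rw [← himg] at hzA
    obtain ⟨b', hb', rfl⟩ := hzA
    by_contra hne
    have hbb : b ≠ b' := fun h => hne (by rw [h]; rfl)
    exact Set.disjoint_left.1 (hdisj b hb b' hb' hbb) hz (hg b' hb').1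
  · rintro rfl
    exact hg b hb

/-- Menger's theorem, phrased with disjoint connected sets instead of paths. -/
theorem exists_linkage {V : Type*} [Finite V] (k : ℕ) (G : SimpleGraph V) (A B : Set V)
    (hsep : ∀ U, Disjoint U B → k ≤ (outerBoundary G U ∪ (A \ U)).ncard) :
    ∃ T ⊆ B, T.ncard = k ∧ ∃ P : V → Set V,
      (∀ b ∈ T, b ∈ P b ∧ (G.induce (P b)).Connected ∧ (P b ∩ A).Nonempty) ∧
      ∀ b ∈ T, ∀ b' ∈ T, b ≠ b' → Disjoint (P b) (P b') := by
  classical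
  induction hn : G.edgeSet.ncard using Nat.strong_induction_on generalizing G A B with
  | _ n ih =>
  by_cases hE : ∃ x y, G.Adj x y
  swap
  · have h1 := hsep (A \ B) Set.disjoint_sdiff_left
    have h2 : outerBoundary G (A \ B) ∪ (A \ (A \ B)) = A ∩ B := by
      ext u
      constructor
      · rintro (⟨-, v, -, hv⟩ | h)
        · exact absurd ⟨_, _, hv⟩ hE
        · simpa using h
      · rintro ⟨h, h'⟩
        exact Or.inr ⟨h, fun h'' => h''.2 h'⟩
    rw [h2] at h1
    obtain ⟨T, hT, hTk⟩ := Set.exists_subset_card_eq h1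
    refine ⟨T, fun z hz => (hT hz).2, hTk, fun b => {b}, fun b hb => ⟨rfl, connected_singleton G b,
      b, rfl, (hT hb).1⟩, fun b _ b' _ hne => by simpa using hne⟩
  obtain ⟨a, b, hab⟩ := hE
  set G' := G.deleteEdges {s(a, b)} with hG'
  have hlt : ∀ H : SimpleGraph V, H ≤ G → ¬ H.Adj a b → H.edgeSet.ncard < n := by
    intro H hH hHab
    rw [← hn]
    refine Set.ncard_lt_ncard ⟨edgeSet_mono hH, fun h => hHab ?_⟩ (Set.toFinite _)
    exact h ((mem_edgeSet G).2 hab)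
  by_cases hcase : ∀ U, Disjoint U B → k ≤ (outerBoundary G' U ∪ (A \ U)).ncard
  · obtain ⟨T, hTB, hTk, P, hP, hPd⟩ := ih _ (hlt G' (deleteEdges_le _) (by simp [hG'])) G' A B
      hcase rfl
    exact ⟨T, hTB, hTk, P, fun b hb => ⟨(hP b hb).1,
      connected_induce_of_le (deleteEdges_le _) (hP b hb).2.1, (hP b hb).2.2⟩, hPd⟩
  push Not at hcase
  obtain ⟨U, hUB, hUk⟩ := hcase
  set S := outerBoundary G' U ∪ (A \ U) with hS
  obtain ⟨y, hy, hyS⟩ : ∃ y ∈ outerBoundary G U ∪ (A \ U), y ∉ S := by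
    by_contra! hcon
    exact absurd (hsep U hUB) (not_le.2 (lt_of_le_of_lt
      (Set.ncard_le_ncard hcon (Set.toFinite _)) hUk))
  have hyb : y ∈ outerBoundary G U := hy.resolve_right fun h => hyS (Or.inr h)
  obtain ⟨hyU, x, hxU, hxy⟩ := hyb
  have hedge : ∀ u v, G.Adj u v → ¬ G'.Adj u v → s(u, v) = s(a, b) := by
    intro u v huv h
    by_contra hne
    exact h (by simpa [hG', huv] using hne)
  have hxye : s(x, y) = s(a, b) := by
    refine hedge x y hxy fun h => hyS (Or.inl ⟨hyU, x, hxU, h⟩)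
  have hSU : Disjoint S U := by
    rw [Set.disjoint_left]
    rintro z (h | h) hz
    · exact h.1 hz
    · exact h.2 hz
  have hcross : ∀ u v, u ∈ U → v ∉ U → G.Adj u v → v ∈ S ∨ (u = x ∧ v = y) := by
    intro u v hu hv huv
    by_cases h : G'.Adj u v
    · exact Or.inl (Or.inl ⟨hv, u, hu, h⟩)
    · have := hedge u v huv h
      rw [← hxye, Sym2.eq_iff] at this
      rcases this with h | ⟨rfl, rfl⟩
      · exact Or.inr h
      · exact absurd hu hyU
  have hxS : x ∉ S := fun h => Set.disjoint_left.1 hSU h hxU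
  have hScard : S.ncard + 1 = k := by
    have h1 := hsep U hUB
    have h2 : outerBoundary G U ∪ (A \ U) ⊆ insert y S := by
      rintro z (⟨hzU, v, hvU, hvz⟩ | h)
      · rcases hcross v z hvU hzU hvz with h | ⟨-, rfl⟩
        · exact Or.inr h
        · exact Or.inl rfl
      · exact Or.inr (Or.inr h)
    have h3 := Set.ncard_le_ncard h2 (Set.toFinite _)
    rw [Set.ncard_insert_of_notMem hyS] at h3
    omega
  have hAU : A ⊆ U ∪ S := fun z hz => by
    by_cases h : z ∈ U
    · exact Or.inl h
    · exact Or.inr (Or.inr ⟨hz, h⟩)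
  have hnotab : ∀ R : Set V, x ∉ R ∨ y ∉ R → ¬ (restrictTo G R).Adj a b := by
    intro R hR h
    rw [Sym2.eq_iff] at hxye
    rcases hxye with ⟨rfl, rfl⟩ | ⟨rfl, rfl⟩
    · exact hR.elim (fun h' => h' h.2.1) fun h' => h' h.2.2
    · exact hR.elim (fun h' => h' h.2.2) fun h' => h' h.2.1
  obtain ⟨T₁, hT₁, hT₁k, P, hP, hPd⟩ := ih _ (hlt (restrictTo G (U ∪ S)) (restrictTo_le _ _)
    (hnotab _ (Or.inr fun h => h.elim hyU hyS))) (restrictTo G (U ∪ S)) A (insert x S) (by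
      intro W hW
      have hxW : x ∉ W := fun h => Set.disjoint_left.1 hW h (Or.inl rfl)
      have hSW : ∀ z ∈ S, z ∉ W := fun z hz h => Set.disjoint_left.1 hW h (Or.inr hz)
      refine (hsep (W ∩ U) (hUB.mono_left Set.inter_subset_right)).trans
        (Set.ncard_le_ncard ?_ (Set.toFinite _))
      rintro z (⟨hz, v, ⟨hvW, hvU⟩, hvz⟩ | ⟨hzA, hz⟩)
      · left
        by_cases hzU : z ∈ U
        · exact ⟨fun h => hz ⟨h, hzU⟩, v, hvW, hvz, Or.inl hvU, Or.inl hzU⟩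
        · rcases hcross v z hvU hzU hvz with h | ⟨rfl, rfl⟩
          · exact ⟨hSW z h, v, hvW, hvz, Or.inl hvU, Or.inr h⟩
          · exact absurd hvW hxW
      · right
        refine ⟨hzA, fun h => ?_⟩
        rcases hAU hzA with h' | h'
        · exact hz ⟨h, h'⟩
        · exact hSW z h' h) rfl
  obtain ⟨T₂, hT₂, hT₂k, Q, hQ, hQd⟩ := ih _ (hlt (restrictTo G Uᶜ) (restrictTo_le _ _)
    (hnotab _ (Or.inl fun h => h hxU))) (restrictTo G Uᶜ) (insert y S) B (by
      intro W hW
      refine (hsep (U ∪ W) (Set.disjoint_union_left.2 ⟨hUB, hW⟩)).trans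
        (Set.ncard_le_ncard ?_ (Set.toFinite _))
      rintro z (⟨hz, v, hv, hvz⟩ | ⟨hzA, hz⟩)
      · have hzU : z ∉ U := fun h => hz (Or.inl h)
        have hzW : z ∉ W := fun h => hz (Or.inr h)
        by_cases hvU : v ∈ U
        · right
          rcases hcross v z hvU hzU hvz with h | ⟨-, rfl⟩
          · exact ⟨Or.inr h, hzW⟩
          · exact ⟨Or.inl rfl, hzW⟩
        · exact Or.inl ⟨hzW, v, hv.resolve_left hvU, hvz, hvU, hzU⟩
      · exact Or.inr ⟨Or.inr ((hAU hzA).resolve_left fun h => hz (Or.inl h)),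
          fun h => hz (Or.inr h)⟩) rfl
  have hT₁eq : T₁ = insert x S := by
    apply Set.eq_of_subset_of_ncard_le hT₁ _ (Set.toFinite _)
    rw [Set.ncard_insert_of_notMem hxS]
    omega
  subst hT₁eq
  obtain ⟨g, hg, hgQ⟩ := exists_bijOn_inter (A := insert y S) (T := T₂) (P := Q)
    (by rw [Set.ncard_insert_of_notMem hyS]; omega) (fun b hb => (hQ b hb).2.2) hQd
  have hPsub : ∀ z ∈ insert x S, P z ⊆ U ∪ S := by
    intro z hz
    obtain ⟨w, hw, hwA⟩ := (hP z hz).2.2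
    exact subset_of_connected_restrictTo (hP z hz).2.1 ⟨w, hw, hAU hwA⟩
  have hQsub : ∀ z ∈ T₂, Q z ⊆ Uᶜ := by
    intro z hz
    obtain ⟨w, hw, hwA⟩ := (hQ z hz).2.2
    refine subset_of_connected_restrictTo (hQ z hz).2.1 ⟨w, hw, ?_⟩
    rcases hwA with rfl | h
    · exact hyU
    · exact fun h' => Set.disjoint_left.1 hSU h h'
  set h : V → V := fun b => if g b = y then x else g b with hh
  have hmem : ∀ b ∈ T₂, h b ∈ insert x S := by
    intro b hb
    by_cases hgb : g b = y
    · simp [hh, hgb]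
    · have := hg.mapsTo hb
      simp only [hh, hgb, if_false]
      exact Or.inr (this.resolve_left hgb)
  have hinj : ∀ b ∈ T₂, ∀ b' ∈ T₂, h b = h b' → b = b' := by
    intro b hb b' hb' hbb
    apply hg.injOn hb hb'
    have h1 := hg.mapsTo hb
    have h2 := hg.mapsTo hb'
    by_cases h3 : g b = y <;> by_cases h4 : g b' = y
    · rw [h3, h4]
    · simp only [hh, h3, h4, if_true, if_false] at hbb
      exact absurd (hbb ▸ h2.resolve_left h4) hxS
    · simp only [hh, h3, h4, if_true, if_false] at hbb
      exact absurd (hbb ▸ h1.resolve_left h3) hxS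
    · simpa only [hh, h3, h4, if_false] using hbb
  have hQP : ∀ b ∈ T₂, ∀ b' ∈ T₂, b ≠ b' → Disjoint (Q b) (P (h b')) := by
    intro b hb b' hb' hne
    rw [Set.disjoint_left]
    intro u hu hu'
    have huS : u ∈ S := (hPsub _ (hmem b' hb') hu').resolve_left (hQsub b hb hu)
    have hug : u = g b := by
      have : u ∈ Q b ∩ insert y S := ⟨hu, Or.inr huS⟩
      rw [hgQ b hb] at this
      exact this
    have hub : h b = u := by
      have : g b ≠ y := fun h' => hyS (h' ▸ hug ▸ huS)
      simp [hh, this, hug]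
    by_cases hub' : u = h b'
    · exact hne (hinj b hb b' hb' (hub.trans hub'))
    · exact Set.disjoint_left.1 (hPd u (Or.inr huS) _ (hmem b' hb') hub') (hP u (Or.inr huS)).1 hu'
  refine ⟨T₂, hT₂, hT₂k, fun b => Q b ∪ P (h b), fun b hb => ⟨Or.inl (hQ b hb).1, ?_, ?_⟩, ?_⟩
  · have hQc := connected_induce_of_le (restrictTo_le _ _) (hQ b hb).2.1
    have hPc := connected_induce_of_le (restrictTo_le _ _) (hP _ (hmem b hb)).2.1
    have hgQb : g b ∈ Q b := by
      have : g b ∈ Q b ∩ insert y S := by rw [hgQ b hb]; rfl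
      exact this.1
    have hPb := (hP _ (hmem b hb)).1
    by_cases hgb : g b = y
    · have hhb : h b = x := by simp [hh, hgb]
      refine connected_induce_union hQc.preconnected hPc.preconnected hgQb hPb ?_
      rw [hgb, hhb]
      exact hxy.symm
    · have hhb : h b = g b := by simp [hh, hgb]
      refine induce_union_connected hQc.preconnected hPc.preconnected ⟨g b, hgQb, ?_⟩
      rw [hhb] at hPb ⊢
      exact hPb
  · obtain ⟨w, hw, hwA⟩ := (hP _ (hmem b hb)).2.2
    exact ⟨w, Or.inr hw, hwA⟩
  · intro b hb b' hb' hne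
    refine Set.disjoint_union_left.2 ⟨Set.disjoint_union_right.2 ⟨hQd b hb b' hb' hne,
      hQP b hb b' hb' hne⟩, Set.disjoint_union_right.2 ⟨(hQP b' hb' b hb hne.symm).symm, ?_⟩⟩
    exact hPd _ (hmem b hb) _ (hmem b' hb') fun h => hne (hinj b hb b' hb' h)

theorem outerBoundary_subset_of_subset {V : Type*} {G : SimpleGraph V} {E E' : Set V}
    (h : E' ⊆ E) : outerBoundary G E' ⊆ E ∪ outerBoundary G E := by
  rintro u ⟨-, v, hv, hvu⟩
  by_cases hu : u ∈ E
  · exact Or.inl hu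
  · exact Or.inr ⟨hu, v, h hv, hvu⟩

/-- If all sets between `E'` and `E` have at least as many boundary vertices outside `Z` as `E`
and `E'` do, then the boundaries of `E` and `E'` are linked by disjoint connected sets. -/
theorem exists_link {V : Type*} [Finite V] {G : SimpleGraph V} {Z E E' C C' : Set V} {k : ℕ}
    (hEE : E' ⊆ E) (hC : C = outerBoundary G E \ Z)
    (hC' : C' = outerBoundary G E' \ Z) (hCC : Disjoint C C') (hCk : C.ncard = k)
    (hCk' : C'.ncard = k)
    (hmin : ∀ X, E' ⊆ X → X ⊆ E → k ≤ (outerBoundary G X \ Z).ncard) :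
    ∃ (F : V → Set V) (next : V → V), Set.BijOn next C C' ∧
      (∀ c ∈ C, c ∈ F c ∧ (G.induce (F c)).Connected ∧ F c ⊆ (E ∪ C) \ (E' ∪ C') ∧
        ∃ u ∈ F c, G.Adj u (next c)) ∧
      ∀ c ∈ C, ∀ c' ∈ C, c ≠ c' → Disjoint (F c) (F c') := by
  set R := (E ∪ C) \ E' with hR
  have hCE : ∀ c ∈ C, c ∉ E := fun c hc => by rw [hC] at hc; exact hc.1.1
  have hC'E : C' ⊆ E := by
    intro c hc
    have h1 := hc
    rw [hC'] at h1
    refine (outerBoundary_subset_of_subset hEE h1.1).resolve_right fun h => ?_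
    exact Set.disjoint_left.1 hCC (by rw [hC]; exact ⟨h, h1.2⟩) hc
  have hC'R : C' ⊆ R := fun c hc => ⟨Or.inl (hC'E hc), by rw [hC'] at hc; exact hc.1.1⟩
  obtain ⟨T, hTC, hTk, P, hP, hPd⟩ := exists_linkage k (restrictTo G R) C' C (by
    intro U hU
    refine (hmin (E' ∪ (U ∩ E)) Set.subset_union_left
      (Set.union_subset hEE Set.inter_subset_right)).trans
        (Set.ncard_le_ncard ?_ (Set.toFinite _))
    rintro u ⟨⟨hu, w, hw, hwu⟩, huZ⟩
    have huE' : u ∉ E' := fun h => hu (Or.inl h)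
    have huU : u ∈ E → u ∉ U := fun h h' => hu (Or.inr ⟨h', h⟩)
    by_cases hwE' : w ∈ E'
    · have huC' : u ∈ C' := by rw [hC']; exact ⟨⟨huE', w, hwE', hwu⟩, huZ⟩
      exact Or.inr ⟨huC', huU (hC'E huC')⟩
    · obtain ⟨hwU, hwE⟩ := hw.resolve_left hwE'
      have huEC : u ∈ E ∪ C := by
        by_cases h : u ∈ E
        · exact Or.inl h
        · exact Or.inr (by rw [hC]; exact ⟨⟨h, w, hwE, hwu⟩, huZ⟩)
      refine Or.inl ⟨?_, w, hwU, hwu, ⟨Or.inl hwE, hwE'⟩, ⟨huEC, huE'⟩⟩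
      rcases huEC with h | h
      · exact huU h
      · exact fun h' => Set.disjoint_left.1 hU h' h)
  have hTeq : T = C := Set.eq_of_subset_of_ncard_le hTC (by omega) (Set.toFinite _)
  subst hTeq
  obtain ⟨g, hg, hgP⟩ := exists_bijOn_inter (A := C') (T := T) (P := P) (by omega)
    (fun b hb => (hP b hb).2.2) hPd
  have hgmem : ∀ c ∈ T, g c ∈ P c := fun c hc => by
    have : g c ∈ P c ∩ C' := by rw [hgP c hc]; rfl
    exact this.1
  have hsub : ∀ c ∈ T, P c ⊆ R := fun c hc => by
    refine subset_of_connected_restrictTo (hP c hc).2.1 ⟨g c, hgmem c hc, hC'R (hg.mapsTo hc)⟩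
  have htrim : ∀ c ∈ T, ∃ F ⊆ P c \ {g c}, c ∈ F ∧ (G.induce F).Connected ∧
      ∃ u ∈ F, G.Adj u (g c) := by
    intro c hc
    refine exists_connected_adj (connected_induce_of_le (restrictTo_le _ _) (hP c hc).2.1)
      (hP c hc).1 (hgmem c hc) fun h => ?_
    exact Set.disjoint_left.1 hCC hc (h ▸ hg.mapsTo hc)
  choose! F hF hcF hFc hFadj using htrim
  refine ⟨F, g, hg, fun c hc => ⟨hcF c hc, hFc c hc, fun u hu => ?_, hFadj c hc⟩,
    fun c hc c' hc' hne => (hPd c hc c' hc' hne).mono (fun u hu => (hF c hc hu).1)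
      fun u hu => (hF c' hc' hu).1⟩
  have h1 := hF c hc hu
  have h2 := hsub c hc h1.1
  refine ⟨h2.1, fun h => h.elim h2.2 fun h' => h1.2 ?_⟩
  rw [← hgP c hc]
  exact ⟨h1.1, h'⟩

theorem mem_outerBoundary_of_between {V : Type*} {G : SimpleGraph V} {A B C : Set V} {u : V}
    (hAB : B ⊆ A) (hBC : C ⊆ B) (hA : u ∈ outerBoundary G A) (hC : u ∈ outerBoundary G C) :
    u ∈ outerBoundary G B := by
  obtain ⟨-, v, hv, hvu⟩ := hC
  exact ⟨fun h => hA.1 (hAB h), v, hBC hv, hvu⟩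

/-- Every long nested sequence of sets with small boundary can be refined to a nested sequence
whose boundaries, up to a bounded number of vertices `Z'`, are disjoint, equicardinal and cannot
be separated from each other by fewer vertices. -/
theorem exists_refined_chain (q k : ℕ) : ∀ z : ℕ, ∃ L : ℕ, ∀ (V : Type) [Finite V]
    (G : SimpleGraph V) (Z : Set V) (D : ℕ → Set V), StrictAntiOn D (Set.Iic L) →
    Z.ncard ≤ z → Disjoint Z (D 0) → (∀ i ≤ L, (outerBoundary G (D i) \ Z).ncard ≤ k) →
    ∃ (Z' : Set V) (k' : ℕ) (E : ℕ → Set V), StrictAntiOn E (Set.Iic q) ∧ E 0 ⊆ D 0 ∧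
      D L ⊆ E q ∧ Z'.ncard ≤ z + k ∧ Disjoint Z' (E 0) ∧ k' ≤ k ∧
      (∀ i ≤ q, (outerBoundary G (E i) \ Z').ncard = k') ∧
      (∀ X, E q ⊆ X → X ⊆ E 0 → k' ≤ (outerBoundary G X \ Z').ncard) ∧
      (∀ i j, i < j → j ≤ q →
        Disjoint (outerBoundary G (E i) \ Z') (outerBoundary G (E j) \ Z')) := by
  induction k with
  | zero =>
    intro z
    refine ⟨q, fun V _ G Z D hD hZ hZD hk => ⟨Z, 0, D, hD, le_rfl, le_rfl, hZ, hZD, le_rfl,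
      fun i hi => Nat.le_zero.1 (hk i hi), fun _ _ _ => Nat.zero_le _, fun i j hij hj => ?_⟩⟩
    have : outerBoundary G (D i) \ Z = ∅ :=
      (Set.ncard_eq_zero (Set.toFinite _)).1 (Nat.le_zero.1 (hk i (hij.le.trans hj)))
    rw [this]
    exact Set.empty_disjoint _
  | succ k ih =>
    intro z
    obtain ⟨l, hl⟩ := ih (z + 1)
    set p := l + 1 with hp
    set M := q * p with hM
    refine ⟨(l + 1) * (M + 1), fun V _ G Z D hD hZ hZD hk => ?_⟩
    set L := (l + 1) * (M + 1) with hL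
    have hanti : ∀ i j, i ≤ j → j ≤ L → D j ⊆ D i := fun i j hij hj =>
      hD.antitoneOn (Set.mem_Iic.2 (hij.trans hj)) (Set.mem_Iic.2 hj) hij
    have hstrict : ∀ i j, i < j → j ≤ L → D j ⊂ D i := fun i j hij hj =>
      hD (Set.mem_Iic.2 (hij.le.trans hj)) (Set.mem_Iic.2 hj) hij
    by_cases ha : ∃ i, i + l ≤ L ∧ ∃ u, u ∉ Z ∧ u ∈ outerBoundary G (D i) ∧
        u ∈ outerBoundary G (D (i + l))
    · obtain ⟨i, hi, u, huZ, hui, hul⟩ := ha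
      obtain ⟨Z', k', E, h1, h2, h3, h4, h5, h6, h7⟩ := hl V G (insert u Z) (fun j => D (i + j))
        (fun a ha b hb hab => hstrict _ _ (by omega) (by simp only [Set.mem_Iic] at hb; omega))
        ((Set.ncard_insert_le _ _).trans (by omega))
        (by
          rw [Set.disjoint_left]
          rintro w (rfl | hw) hwD
          · exact hui.1 hwD
          · exact Set.disjoint_left.1 hZD hw (hanti 0 _ (Nat.zero_le _) (by omega) hwD))
        (by
          intro j hj
          have hu : u ∈ outerBoundary G (D (i + j)) :=
            mem_outerBoundary_of_between (hanti _ _ (by omega) (by omega))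
              (hanti _ _ (by omega) (by omega)) hui hul
          have hss : insert u (outerBoundary G (D (i + j)) \ insert u Z) ⊆
              outerBoundary G (D (i + j)) \ Z := by
            rintro w (rfl | hw)
            · exact ⟨hu, huZ⟩
            · exact ⟨hw.1, fun h => hw.2 (Or.inr h)⟩
          have h := Set.ncard_le_ncard hss (Set.toFinite _)
          rw [Set.ncard_insert_of_notMem (fun h => h.2 (Or.inl rfl))] at h
          have := hk (i + j) (by omega)
          omega)
      exact ⟨Z', k', E, h1, h2.trans (hanti _ _ (by omega) (by omega)),
        (hanti _ _ hi le_rfl).trans h3, by omega, h5, by omega, h7⟩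
    by_cases hb : ∀ b ≤ l, ∃ X, D (b * (M + 1) + M) ⊆ X ∧ X ⊆ D (b * (M + 1)) ∧
        (outerBoundary G X \ Z).ncard ≤ k
    · choose! X hX1 hX2 hX3 using hb
      have hbound : ∀ b ≤ l, b * (M + 1) + M < L := fun b hb => by
        have := Nat.mul_le_mul_right (M + 1) hb
        rw [hL, Nat.add_mul]
        omega
      obtain ⟨Z', k', E, h1, h2, h3, h4, h5, h6, h7⟩ := hl V G Z X
        (by
          intro a ha b hb hab
          simp only [Set.mem_Iic] at ha hb
          have h1 := hX1 a ha
          have h2 := hX2 b hb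
          have h3 := Nat.mul_le_mul_right (M + 1) (Nat.succ_le_of_lt hab)
          rw [Nat.succ_mul] at h3
          have h4 := hbound b hb
          exact (h2.trans_ssubset (hstrict _ _ (by omega) (by omega))).trans_subset h1)
        (by omega)
        (hZD.mono_right ((hX2 0 (Nat.zero_le _)).trans (by simp)))
        (fun b hb => hX3 b hb)
      have h0 := hX2 0 (Nat.zero_le _)
      rw [Nat.zero_mul] at h0
      exact ⟨Z', k', E, h1, h2.trans h0,
        ((hanti _ _ (hbound l le_rfl).le le_rfl).trans (hX1 l le_rfl)).trans h3, by omega, h5,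
        by omega, h7⟩
    · push Not at hb
      obtain ⟨b, hbl, hb⟩ := hb
      have hbL : b * (M + 1) + M ≤ L := by
        have := Nat.mul_le_mul_right (M + 1) hbl
        rw [hL, Nat.add_mul]
        omega
      set s := b * (M + 1) with hs
      have hip : ∀ i ≤ q, i * p ≤ M := fun i hi => Nat.mul_le_mul_right p hi
      refine ⟨Z, k + 1, fun i => D (s + i * p), ?_, ?_, ?_, by omega, ?_, le_rfl, ?_, ?_, ?_⟩
      · intro i _ j hj hij
        have hj' := hip j hj
        refine hstrict _ _ ?_ (by omega)
        have := Nat.mul_lt_mul_of_pos_right hij (show 0 < p by omega)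
        omega
      · exact hanti _ _ (Nat.zero_le _) (by omega)
      · exact hanti _ _ (by omega) le_rfl
      · exact hZD.mono_right (hanti _ _ (Nat.zero_le _) (by omega))
      · intro i hi
        have := hip i hi
        refine le_antisymm (hk _ (by omega)) ?_
        exact hb _ (hanti _ _ (by omega) (by omega)) (hanti _ _ (by omega) (by omega))
      · intro X hX1 hX2
        exact hb X hX1 (by simpa using hX2)
      · intro i j hij hj
        rw [Set.disjoint_left]
        rintro u ⟨hu1, huZ⟩ ⟨hu2, -⟩
        have h1 := hip j hj
        have h2 := Nat.mul_le_mul_right p (Nat.succ_le_of_lt hij)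
        rw [Nat.succ_mul] at h2
        refine ha ⟨s + i * p, by omega, u, huZ, hu1, ?_⟩
        exact mem_outerBoundary_of_between (hanti _ _ (by omega) (by omega))
          (hanti _ _ (by omega) (by omega)) hu1 hu2

theorem connected_iUnion_Ico {V : Type*} {G : SimpleGraph V} {B : ℕ → Set V} {a b : ℕ}
    (hab : a < b) (hconn : ∀ r, a ≤ r → r < b → (G.induce (B r)).Connected)
    (hadj : ∀ r, a ≤ r → r + 1 < b → ∃ u ∈ B r, ∃ v ∈ B (r + 1), G.Adj u v) :
    (G.induce (⋃ r ∈ Set.Ico a b, B r)).Connected := by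
  induction b, hab using Nat.le_induction with
  | base =>
    have : (⋃ r ∈ Set.Ico a (a + 1), B r) = B a := by
      ext u
      simp only [Set.mem_iUnion, Set.mem_Ico, exists_prop]
      constructor
      · rintro ⟨r, hr, hu⟩
        have : r = a := by omega
        exact this ▸ hu
      · exact fun hu => ⟨a, by omega, hu⟩
    rw [this]
    exact hconn a le_rfl (by omega)
  | succ b hb ih =>
    have h1 := ih (fun r h h' => hconn r h (by omega)) (fun r h h' => hadj r h (by omega))
    have : (⋃ r ∈ Set.Ico a (b + 1), B r) = (⋃ r ∈ Set.Ico a b, B r) ∪ B b := by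
      ext u
      simp only [Set.mem_iUnion, Set.mem_Ico, exists_prop, Set.mem_union]
      constructor
      · rintro ⟨r, hr, hu⟩
        rcases Nat.lt_or_ge r b with h | h
        · exact Or.inl ⟨r, by omega, hu⟩
        · have : r = b := by omega
          exact Or.inr (this ▸ hu)
      · rintro (⟨r, hr, hu⟩ | hu)
        · exact ⟨r, by omega, hu⟩
        · exact ⟨b, by omega, hu⟩
    rw [this]
    obtain ⟨c, rfl⟩ : ∃ c, b = c + 1 := ⟨b - 1, by omega⟩
    obtain ⟨u, hu, v, hv, huv⟩ := hadj c (by omega) (by omega)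
    refine connected_induce_union h1.preconnected
      (hconn (c + 1) (by omega) (by omega)).preconnected ?_ hv huv
    simp only [Set.mem_iUnion, Set.mem_Ico, exists_prop]
    exact ⟨c, by omega, hu⟩

theorem isMinorOf_completeBipartiteGraph {V : Type*} {G : SimpleGraph V} {t m : ℕ}
    (N : Finset V) (hN : N.card = t) (v : Fin m → V) (hv : Function.Injective v)
    (hvN : ∀ i, v i ∉ N) (hadj : ∀ i, ∀ z ∈ N, G.Adj (v i) z) :
    IsMinorOf (completeBipartiteGraph (Fin t) (Fin m)) G := by
  have e : Fin t ≃ N := (N.equivFinOfCardEq hN).symm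
  refine ⟨Sum.elim (fun i => {(e i : V)}) (fun j => {v j}), ?_, ?_, ?_, ?_⟩
  · rintro (i | j) <;> simp
  · rintro (i | j)
    · exact connected_singleton G _
    · exact connected_singleton G _
  · rintro (i | i) (j | j) hij
    · simp only [Sum.elim_inl, Set.disjoint_singleton]
      intro h
      exact hij (congrArg Sum.inl (e.injective (Subtype.ext h)))
    · simp only [Sum.elim_inl, Sum.elim_inr, Set.disjoint_singleton]
      intro h
      exact hvN j (h ▸ (e i).2)
    · simp only [Sum.elim_inl, Sum.elim_inr, Set.disjoint_singleton]
      intro h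
      exact hvN i (h ▸ (e j).2)
    · simp only [Sum.elim_inr, Set.disjoint_singleton]
      intro h
      exact hij (congrArg Sum.inr (hv h))
  · rintro (i | i) (j | j) hij
    · simp at hij
    · exact ⟨_, rfl, _, rfl, (hadj j _ (e i).2).symm⟩
    · exact ⟨_, rfl, _, rfl, hadj i _ (e j).2⟩
    · simp at hij

theorem isMinorOf_IplusP {V : Type*} {G : SimpleGraph V} {n m : ℕ} (O : Finset V)
    (hO : O.card = n) (X : V → Set V) (W : ℕ → Set V)
    (hX : ∀ l ∈ O, (G.induce (X l)).Connected)
    (hW : ∀ j < m, (G.induce (W j)).Connected)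
    (hXX : ∀ l ∈ O, ∀ l' ∈ O, l ≠ l' → Disjoint (X l) (X l'))
    (hXW : ∀ l ∈ O, ∀ j < m, Disjoint (X l) (W j))
    (hWW : ∀ i j, i < j → j < m → Disjoint (W i) (W j))
    (hadj : ∀ j, j + 1 < m → ∃ u ∈ W j, ∃ v ∈ W (j + 1), G.Adj u v)
    (hadj' : ∀ l ∈ O, ∀ j < m, ∃ u ∈ X l, ∃ v ∈ W j, G.Adj u v) :
    IsMinorOf (IplusP n m) G := by
  have e : Fin n ≃ O := (O.equivFinOfCardEq hO).symm
  have hconn : ∀ w, (G.induce (Sum.elim (fun i => X (e i)) (fun j : Fin m => W j) w)).Connected := by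
    rintro (i | j)
    · exact hX _ (e i).2
    · exact hW _ j.2
  have hsymm : ∀ {A B : Set V}, (∃ u ∈ A, ∃ v ∈ B, G.Adj u v) → ∃ u ∈ B, ∃ v ∈ A, G.Adj u v :=
    fun ⟨u, hu, v, hv, h⟩ => ⟨v, hv, u, hu, h.symm⟩
  refine ⟨Sum.elim (fun i => X (e i)) (fun j => W j), fun w => ?_, hconn, ?_, ?_⟩
  · exact Set.nonempty_coe_sort.1 (hconn w).nonempty
  · rintro (i | i) (j | j) hij
    · refine hXX _ (e i).2 _ (e j).2 fun h => hij ?_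
      exact congrArg Sum.inl (e.injective (Subtype.ext h))
    · exact hXW _ (e i).2 _ j.2
    · exact (hXW _ (e j).2 _ i.2).symm
    · have hne : (i : ℕ) ≠ j := fun h => hij (congrArg Sum.inr (Fin.ext h))
      rcases lt_or_gt_of_ne hne with h | h
      · exact hWW _ _ h j.2
      · exact (hWW _ _ h i.2).symm
  · have key : ∀ a b : Fin n ⊕ Fin m, ((∃ i j, a = Sum.inl i ∧ b = Sum.inr j) ∨
        (∃ i j : Fin m, a = Sum.inr i ∧ b = Sum.inr j ∧ (i : ℕ) + 1 = (j : ℕ))) →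
        ∃ u ∈ Sum.elim (fun i => X (e i)) (fun j : Fin m => W j) a,
          ∃ v ∈ Sum.elim (fun i => X (e i)) (fun j : Fin m => W j) b, G.Adj u v := by
      rintro a b (⟨i, j, rfl, rfl⟩ | ⟨i, j, rfl, rfl, hij⟩)
      · exact hadj' _ (e i).2 _ j.2
      · have h := hadj i (hij ▸ j.2)
        rw [hij] at h
        exact h
    intro a b hab
    rw [IplusP, SimpleGraph.fromRel_adj] at hab
    rcases hab.2 with h | h
    · exact key a b h
    · exact hsymm (key b a h)

/-- Disjoint strands `B · p` together with many vertices attached to at least `t` strands or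
vertices of `Z` yield one of the two unavoidable minors. -/
theorem isMinorOf_of_strands {V : Type*} {G : SimpleGraph V} {t m K Q : ℕ} {Z P : Set V}
    (S : Finset V) (hS : ∀ l, l ∈ S ↔ l ∈ Z ∪ P) (hSK : S.card ≤ K)
    (hQ : (K + 1) * 2 ^ K * m < Q) (hZP : Disjoint Z P)
    (B : ℕ → V → Set V) (hBconn : ∀ r < Q, ∀ p ∈ P, (G.induce (B r p)).Connected)
    (hBadj : ∀ r, r + 1 < Q → ∀ p ∈ P, ∃ u ∈ B r p, ∃ v ∈ B (r + 1) p, G.Adj u v)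
    (hBB : ∀ r < Q, ∀ s < Q, ∀ p ∈ P, ∀ p' ∈ P, (r ≠ s ∨ p ≠ p') → Disjoint (B r p) (B s p'))
    (hBZ : ∀ r < Q, ∀ p ∈ P, Disjoint Z (B r p))
    (v : ℕ → V) (hvZ : ∀ r < Q, v r ∉ Z) (hv : ∀ r < Q, ∀ s < Q, v r = v s → r = s)
    (hvB : ∀ r < Q, ∀ s < Q, ∀ p ∈ P, v r ∈ B s p → r = s)
    (hN : ∀ r < Q, ∃ N ⊆ S, N.card = t ∧ ∀ l ∈ N, (l ∈ Z ∧ G.Adj (v r) l) ∨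
      (l ∈ P ∧ ∃ u ∈ B r l, G.Adj (v r) u)) :
    IsMinorOf (completeBipartiteGraph (Fin t) (Fin m)) G ∨ IsMinorOf (IplusP (t - 1) m) G := by
  classical
  have hout : ∀ r < Q, ∃ o : Option V × Finset V, o ∈ (Finset.insertNone S) ×ˢ S.powerset ∧
      (∀ l ∈ o.2, (l ∈ Z ∧ G.Adj (v r) l) ∨ (l ∈ P ∧ ∃ u ∈ B r l, G.Adj (v r) u)) ∧
      (o.1 = none → o.2.card = t ∧ ∀ l ∈ o.2, l ∈ Z) ∧
      (∀ p, o.1 = some p → p ∈ P ∧ p ∉ o.2 ∧ o.2.card = t - 1 ∧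
        (v r ∈ B r p ∨ ∃ u ∈ B r p, G.Adj (v r) u) ∧
        ∀ p' ∈ o.2, p' ∈ P → v r ∉ B r p') := by
    intro r hr
    obtain ⟨N, hNS, hNt, hNadj⟩ := hN r hr
    by_cases hNZ : ∀ l ∈ N, l ∈ Z
    · refine ⟨(none, N), ?_, hNadj, fun _ => ⟨hNt, hNZ⟩, fun p hp => by simp at hp⟩
      simp [hNS]
    have hhost : ∃ p ∈ P, (v r ∈ B r p ∨ ∃ u ∈ B r p, G.Adj (v r) u) ∧
        ∀ p' ∈ P, p' ≠ p → v r ∉ B r p' := by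
      by_cases h : ∃ p ∈ P, v r ∈ B r p
      · obtain ⟨p, hp, hvp⟩ := h
        refine ⟨p, hp, Or.inl hvp, fun p' hp' hne hvp' => ?_⟩
        exact Set.disjoint_left.1 (hBB r hr r hr p hp p' hp' (Or.inr hne.symm)) hvp hvp'
      · push Not at hNZ h
        obtain ⟨l, hl, hlZ⟩ := hNZ
        obtain ⟨hlP, hu⟩ := (hNadj l hl).resolve_left fun h => hlZ h.1
        exact ⟨l, hlP, Or.inr hu, fun p' hp' _ => h p' hp'⟩
    obtain ⟨p, hp, hp2, hp3⟩ := hhost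
    obtain ⟨O, hO, hOt⟩ : ∃ O ⊆ N.erase p, O.card = t - 1 := by
      apply Finset.exists_subset_card_eq
      have := Finset.pred_card_le_card_erase (s := N) (a := p)
      omega
    refine ⟨(some p, O), ?_, fun l hl => hNadj l (Finset.mem_of_mem_erase (hO hl)),
      fun h => by simp at h, ?_⟩
    · simp only [Finset.mem_product, Finset.some_mem_insertNone, Finset.mem_powerset]
      exact ⟨(hS p).2 (Or.inr hp), hO.trans ((Finset.erase_subset _ _).trans hNS)⟩
    · intro p' hp'
      obtain rfl : p = p' := by simpa using hp'
      exact ⟨hp, fun h => (Finset.notMem_erase p N) (hO h), hOt, hp2,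
        fun p' hp' hpP => hp3 p' hpP (Finset.ne_of_mem_erase (hO hp'))⟩
  choose! o ho hoadj honone hosome using hout
  obtain ⟨⟨h, O⟩, -, hcard⟩ := Finset.exists_lt_card_fiber_of_mul_lt_card_of_maps_to
    (s := Finset.range Q) (t := (Finset.insertNone S) ×ˢ S.powerset) (f := o) (n := m)
    (fun r hr => ho r (Finset.mem_range.1 hr)) (by
      rw [Finset.card_range, Finset.card_product, Finset.card_insertNone, Finset.card_powerset]
      refine lt_of_le_of_lt ?_ hQ
      gcongr
      norm_num)
  obtain ⟨R, hRsub, hRcard⟩ := Finset.exists_subset_card_eq (Nat.succ_le_of_lt hcard)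
  set e' : Fin (m + 1) ↪o ℕ := R.orderEmbOfFin hRcard with he'
  set e : ℕ → ℕ := fun j => e' (Fin.ofNat (m + 1) j) with he
  have hemem : ∀ j, e j < Q ∧ o (e j) = (h, O) := fun j => by
    have h1 := hRsub (R.orderEmbOfFin_mem hRcard (Fin.ofNat (m + 1) j))
    rw [Finset.mem_filter, Finset.mem_range] at h1
    exact h1
  have hemono : ∀ i j, i < j → j ≤ m → e i < e j := fun i j hij hj => by
    refine e'.lt_iff_lt.2 ?_
    rw [Fin.lt_def]
    simp only [Fin.val_ofNat]
    rw [Nat.mod_eq_of_lt (by omega), Nat.mod_eq_of_lt (by omega)]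
    exact hij
  have heQ := fun j => (hemem j).1
  have hinj : ∀ i j, i ≤ m → j ≤ m → v (e i) = v (e j) → i = j := by
    intro i j hi hj hij
    have h1 := hv _ (heQ i) _ (heQ j) hij
    rcases lt_trichotomy i j with h2 | h2 | h2
    · exact absurd h1 (hemono i j h2 hj).ne
    · exact h2
    · exact absurd h1 (hemono j i h2 hi).ne'
  cases h with
  | none =>
    left
    have hO1 := honone (e 0) (heQ 0) (by rw [(hemem 0).2])
    rw [(hemem 0).2] at hO1
    refine isMinorOf_completeBipartiteGraph O hO1.1 (fun j => v (e j)) ?_ ?_ ?_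
    · intro i j hij
      exact Fin.ext (hinj i j i.2.le j.2.le hij)
    · exact fun i hi => hvZ _ (heQ i) (hO1.2 _ hi)
    · intro i z hz
      have h1 := hoadj (e i) (heQ i)
      rw [(hemem i).2] at h1
      rcases h1 z hz with h2 | h2
      · exact h2.2
      · exact absurd h2.1 (Set.disjoint_left.1 hZP (hO1.2 z hz))
  | some p =>
    right
    have hos : ∀ j, p ∈ P ∧ p ∉ O ∧ O.card = t - 1 ∧
        (v (e j) ∈ B (e j) p ∨ ∃ u ∈ B (e j) p, G.Adj (v (e j)) u) ∧
        ∀ p' ∈ O, p' ∈ P → v (e j) ∉ B (e j) p' := fun j => by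
      have h1 := hosome (e j) (heQ j) p (by rw [(hemem j).2])
      rwa [(hemem j).2] at h1
    have hoa : ∀ j, ∀ l ∈ O, (l ∈ Z ∧ G.Adj (v (e j)) l) ∨
        (l ∈ P ∧ ∃ u ∈ B (e j) l, G.Adj (v (e j)) u) := fun j => by
      have h1 := hoadj (e j) (heQ j)
      rwa [(hemem j).2] at h1
    obtain ⟨hpP, hpO, hOt, -, -⟩ := hos 0
    have hOP : ∀ l ∈ O, l ∉ Z → l ∈ P := fun l hl hlZ =>
      ((hoa 0 l hl).resolve_left fun h => hlZ h.1).1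
    have hvO : ∀ j, ∀ l ∈ O, l ∈ P → ∀ r < Q, v (e j) ∉ B r l := fun j l hl hlP r hr hvr => by
      have h1 := hvB _ (heQ j) r hr l hlP hvr
      exact (hos j).2.2.2.2 l hl hlP (h1 ▸ hvr)
    have hQ0 : 0 < Q := by omega
    set X : V → Set V := fun l => if l ∈ Z then {l} else ⋃ r ∈ Set.Ico 0 Q, B r l with hXdef
    set W : ℕ → Set V := fun j => (⋃ r ∈ Set.Ico (e j) (e (j + 1)), B r p) ∪ {v (e j)} with hWdef
    have hXmem : ∀ l ∈ O, ∀ u, u ∈ X l ↔ (l ∈ Z ∧ u = l) ∨ (l ∉ Z ∧ ∃ r < Q, u ∈ B r l) := by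
      intro l hl u
      by_cases hlZ : l ∈ Z
      · simp [hXdef, hlZ]
      · simp [hXdef, hlZ]
    have hWmem : ∀ j u, u ∈ W j ↔ (∃ r, e j ≤ r ∧ r < e (j + 1) ∧ u ∈ B r p) ∨ u = v (e j) := by
      intro j u
      simp [hWdef, and_assoc, or_comm]
    refine isMinorOf_IplusP O hOt X W ?_ ?_ ?_ ?_ ?_ ?_ ?_
    · intro l hl
      by_cases hlZ : l ∈ Z
      · rw [show X l = {l} from if_pos hlZ]
        exact connected_singleton G l
      · have hlP := hOP l hl hlZ
        rw [show X l = ⋃ r ∈ Set.Ico 0 Q, B r l from if_neg hlZ]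
        exact connected_iUnion_Ico hQ0 (fun r _ hr => hBconn r hr l hlP)
          (fun r _ hr => hBadj r hr l hlP)
    · intro j hj
      have hlt := hemono j (j + 1) (by omega) (by omega)
      have hc : (G.induce (⋃ r ∈ Set.Ico (e j) (e (j + 1)), B r p)).Connected :=
        connected_iUnion_Ico hlt (fun r _ hr => hBconn r (hr.trans (heQ _)) p hpP)
          (fun r _ hr => hBadj r (hr.trans (heQ _)) p hpP)
      have hsub : ∀ u ∈ B (e j) p, u ∈ ⋃ r ∈ Set.Ico (e j) (e (j + 1)), B r p := fun u hu => by
        simp only [Set.mem_iUnion, Set.mem_Ico, exists_prop]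
        exact ⟨e j, ⟨le_rfl, hlt⟩, hu⟩
      rcases (hos j).2.2.2.1 with h1 | ⟨u, hu, h1⟩
      · have : W j = ⋃ r ∈ Set.Ico (e j) (e (j + 1)), B r p :=
          Set.union_eq_self_of_subset_right (Set.singleton_subset_iff.2 (hsub _ h1))
        rw [this]
        exact hc
      · exact connected_induce_union hc.preconnected (connected_singleton G _).preconnected
          (hsub u hu) rfl h1.symm
    · intro l hl l' hl' hne
      rw [Set.disjoint_left]
      intro u hu hu'
      rw [hXmem l hl] at hu
      rw [hXmem l' hl'] at hu'
      rcases hu with ⟨h1, rfl⟩ | ⟨h1, r, hr, hur⟩ <;> rcases hu' with ⟨h2, h3⟩ | ⟨h2, s, hs, hus⟩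
      · exact hne h3
      · exact Set.disjoint_left.1 (hBZ s hs l' (hOP l' hl' h2)) h1 hus
      · exact Set.disjoint_left.1 (hBZ r hr l (hOP l hl h1)) h2 (h3 ▸ hur)
      · exact Set.disjoint_left.1 (hBB r hr s hs l (hOP l hl h1) l' (hOP l' hl' h2) (Or.inr hne))
          hur hus
    · intro l hl j hj
      rw [Set.disjoint_left]
      intro u hu hu'
      rw [hXmem l hl] at hu
      rw [hWmem] at hu'
      have hpl : l ≠ p := fun h => hpO (h ▸ hl)
      rcases hu with ⟨h1, rfl⟩ | ⟨h1, r, hr, hur⟩ <;> rcases hu' with ⟨s, -, hs, hus⟩ | h3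
      · exact Set.disjoint_left.1 (hBZ s (hs.trans (heQ _)) p hpP) h1 hus
      · exact hvZ _ (heQ j) (h3 ▸ h1)
      · exact Set.disjoint_left.1 (hBB r hr s (hs.trans (heQ _)) l (hOP l hl h1) p hpP
          (Or.inr hpl)) hur hus
      · exact hvO j l hl (hOP l hl h1) r hr (h3 ▸ hur)
    · intro i j hij hj
      rw [Set.disjoint_left]
      intro u hu hu'
      rw [hWmem] at hu hu'
      have h0 : e (i + 1) ≤ e j := by
        rcases Nat.lt_or_ge (i + 1) j with h | h
        · exact (hemono _ _ h (by omega)).le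
        · rw [show i + 1 = j by omega]
      have h1 := hemono i j hij (by omega)
      have h2 := hemono j (j + 1) (by omega) (by omega)
      have hQj := heQ (j + 1)
      rcases hu with ⟨r, hr1, hr2, hur⟩ | rfl <;> rcases hu' with ⟨s, hs1, hs2, hus⟩ | h3
      · exact Set.disjoint_left.1 (hBB r (by omega) s (by omega) p hpP p hpP (Or.inl (by omega)))
          hur hus
      · have := hvB _ (heQ j) r (by omega) p hpP (h3 ▸ hur)
        omega
      · have := hvB _ (heQ i) s (by omega) p hpP hus
        omega
      · have := hinj i j (by omega) (by omega) h3
        omega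
    · intro j hj
      have h1 := hemono j (j + 1) (by omega) (by omega)
      have h2 := hemono (j + 1) (j + 2) (by omega) (by omega)
      have h3 := heQ (j + 1)
      obtain ⟨u, hu, w, hw, huw⟩ := hBadj (e (j + 1) - 1) (by omega) p hpP
      rw [show e (j + 1) - 1 + 1 = e (j + 1) by omega] at hw
      refine ⟨u, (hWmem _ _).2 (Or.inl ⟨_, by omega, by omega, hu⟩), w,
        (hWmem _ _).2 (Or.inl ⟨_, le_rfl, h2, hw⟩), huw⟩
    · intro l hl j hj
      have hvW : v (e j) ∈ W j := (hWmem _ _).2 (Or.inr rfl)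
      by_cases hlZ : l ∈ Z
      · have h1 := (hoa j l hl).resolve_right fun h => Set.disjoint_left.1 hZP hlZ h.1
        exact ⟨l, (hXmem l hl l).2 (Or.inl ⟨hlZ, rfl⟩), v (e j), hvW, h1.2.symm⟩
      · obtain ⟨-, u, hu, h1⟩ := (hoa j l hl).resolve_left fun h => hlZ h.1
        exact ⟨u, (hXmem l hl u).2 (Or.inr ⟨hlZ, e j, heQ j, hu⟩), v (e j), hvW, h1.symm⟩

/-- If a graph has no `t`-island between the first and last set of a long nested sequence of sets
with small boundary, then it contains one of the two unavoidable minors. -/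
theorem exists_length_forall_isMinorOf (t m k : ℕ) : ∃ L : ℕ, ∀ (V : Type) [Finite V]
    (G : SimpleGraph V) (D : ℕ → Set V), StrictAntiOn D (Set.Iic L) →
    (∀ i ≤ L, (outerBoundary G (D i)).ncard ≤ k) → (∀ S ⊆ D 0 \ D L, ¬ IsIsland G t S) →
    IsMinorOf (completeBipartiteGraph (Fin t) (Fin m)) G ∨ IsMinorOf (IplusP (t - 1) m) G := by
  classical
  set Q := (2 * k + 1) * 2 ^ (2 * k) * m + 1 with hQ
  obtain ⟨L, hL⟩ := exists_refined_chain (6 * Q) k 0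
  refine ⟨L, fun V _ G D hD hDk hisl => ?_⟩
  obtain ⟨Z, k', E, hE, hE0, hEL, hZ, hZE, hk', hEk, hmin, hdisj⟩ :=
    hL V G ∅ D hD (by simp) (Set.empty_disjoint _) (by simpa using hDk)
  have hanti : ∀ {i j}, i ≤ j → j ≤ 6 * Q → E j ⊆ E i := fun {i j} hij hj =>
    hE.antitoneOn (Set.mem_Iic.2 (hij.trans hj)) (Set.mem_Iic.2 hj) hij
  set C : ℕ → Set V := fun i => outerBoundary G (E i) \ Z with hC
  have hCC : ∀ {i j u}, i < j → j ≤ 6 * Q → u ∈ C i → u ∉ C j := fun {i j u} hij hj hi hj' =>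
    Set.disjoint_left.1 (hdisj i j hij hj) hi hj'
  have hEZ : ∀ {i u}, i ≤ 6 * Q → u ∈ E i → u ∉ Z := fun {i u} hi hu hZ =>
    Set.disjoint_left.1 hZE hZ (hanti (Nat.zero_le _) hi hu)
  have hUanti : ∀ {i j}, i ≤ j → j ≤ 6 * Q → E j ∪ C j ⊆ E i ∪ C i := by
    rintro i j hij hj u (hu | hu)
    · exact Or.inl (hanti hij hj hu)
    · rcases outerBoundary_subset_of_subset (hanti hij hj) hu.1 with h | h
      · exact Or.inl h
      · exact Or.inr ⟨h, hu.2⟩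
  have hUZ : ∀ {i u}, i ≤ 6 * Q → u ∈ E i ∪ C i → u ∉ Z := by
    rintro i u hi (hu | hu)
    · exact hEZ hi hu
    · exact hu.2
  have hlink : ∀ s, ∃ (F : V → Set V) (next : V → V), s < 2 * Q →
      Set.BijOn next (C (3 * s)) (C (3 * s + 3)) ∧
      (∀ c ∈ C (3 * s), c ∈ F c ∧ (G.induce (F c)).Connected ∧
        F c ⊆ (E (3 * s) ∪ C (3 * s)) \ (E (3 * s + 3) ∪ C (3 * s + 3)) ∧
        ∃ u ∈ F c, G.Adj u (next c)) ∧
      ∀ c ∈ C (3 * s), ∀ c' ∈ C (3 * s), c ≠ c' → Disjoint (F c) (F c') := by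
    intro s
    by_cases hs : s < 2 * Q
    · obtain ⟨F, next, h⟩ := exists_link (G := G) (Z := Z) (E := E (3 * s)) (E' := E (3 * s + 3))
        (hanti (by omega) (by omega)) rfl rfl (hdisj _ _ (by omega) (by omega))
        (hEk _ (by omega)) (hEk _ (by omega)) (fun X h1 h2 => hmin X
          ((hanti (by omega) le_rfl).trans h1) (h2.trans (hanti (Nat.zero_le _) (by omega))))
      exact ⟨F, next, fun _ => h⟩
    · exact ⟨fun _ => ∅, id, fun h => absurd h hs⟩
  choose F next hFn using hlink
  set c : ℕ → V → V := fun s p => Nat.rec p (fun s x => next s x) s with hc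
  have hcbij : ∀ s ≤ 2 * Q, Set.BijOn (c s) (C 0) (C (3 * s)) := by
    intro s
    induction s with
    | zero => exact fun _ => Set.bijOn_id _
    | succ s ih =>
      intro hs
      exact (hFn s (by omega)).1.comp (ih (by omega))
  set Seg : ℕ → V → Set V := fun s p => F s (c s p) with hSeg
  have hSegspec : ∀ s < 2 * Q, ∀ p ∈ C 0, c s p ∈ Seg s p ∧ (G.induce (Seg s p)).Connected ∧
      Seg s p ⊆ (E (3 * s) ∪ C (3 * s)) \ (E (3 * s + 3) ∪ C (3 * s + 3)) ∧
      ∃ u ∈ Seg s p, G.Adj u (c (s + 1) p) := fun s hs p hp =>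
    (hFn s hs).2.1 _ ((hcbij s hs.le).mapsTo hp)
  have hSegdisj : ∀ s < 2 * Q, ∀ s' < 2 * Q, ∀ p ∈ C 0, ∀ p' ∈ C 0, (s ≠ s' ∨ p ≠ p') →
      Disjoint (Seg s p) (Seg s' p') := by
    have hlt : ∀ s s', s < s' → s' < 2 * Q → ∀ p ∈ C 0, ∀ p' ∈ C 0,
        Disjoint (Seg s p) (Seg s' p') := fun s s' hss hs' p hp p' hp' => by
      rw [Set.disjoint_left]
      intro u hu hu'
      exact ((hSegspec s (by omega) p hp).2.2.1 hu).2
        (hUanti (by omega) (by omega) ((hSegspec s' hs' p' hp').2.2.1 hu').1)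
    intro s hs s' hs' p hp p' hp' hne
    rcases lt_trichotomy s s' with h | rfl | h
    · exact hlt s s' h hs' p hp p' hp'
    · refine (hFn s hs).2.2 _ ((hcbij s hs.le).mapsTo hp) _ ((hcbij s hs.le).mapsTo hp') fun h => ?_
      exact hne.elim (fun h => h rfl) fun h' => h' ((hcbij s hs.le).injOn hp hp' h)
    · exact (hlt s' s h hs p' hp' p hp).symm
  set B : ℕ → V → Set V := fun r p => Seg (2 * r) p ∪ Seg (2 * r + 1) p with hB
  have hBsub : ∀ r < Q, ∀ p ∈ C 0,
      B r p ⊆ (E (6 * r) ∪ C (6 * r)) \ (E (6 * r + 6) ∪ C (6 * r + 6)) := by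
    rintro r hr p hp u (hu | hu)
    · have h1 := (hSegspec _ (by omega) p hp).2.2.1 hu
      rw [show 3 * (2 * r) = 6 * r by omega] at h1
      exact ⟨h1.1, fun h => h1.2 (hUanti (by omega) (by omega) h)⟩
    · have h1 := (hSegspec _ (by omega) p hp).2.2.1 hu
      rw [show 3 * (2 * r + 1) = 6 * r + 3 by omega] at h1
      exact ⟨hUanti (by omega) (by omega) h1.1, h1.2⟩
  set M : ℕ → Set V := fun r => E (6 * r) \ (E (6 * r + 3) ∪ C (6 * r + 3)) with hM
  have hMne : ∀ r < Q, (M r).Nonempty := by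
    intro r hr
    obtain ⟨u, hu, hu'⟩ := Set.exists_of_ssubset
      (hE (Set.mem_Iic.2 (by omega)) (Set.mem_Iic.2 (by omega)) (Nat.lt_succ_self (6 * r)))
    refine ⟨u, hu, ?_⟩
    rintro (h | h)
    · exact hu' (hanti (by omega) (by omega) h)
    · obtain ⟨⟨-, x, hx, hxu⟩, hZu⟩ := id h
      exact hCC (by omega) (by omega)
        ⟨⟨hu', x, hanti (by omega) (by omega) hx, hxu⟩, hZu⟩ h
  have hMv : ∀ r, ∃ v, r < Q → v ∈ M r ∧ t ≤ (G.neighborSet v \ M r).ncard := by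
    intro r
    by_cases hr : r < Q
    · have h1 := hisl (M r) fun u hu => ⟨hE0 (hanti (Nat.zero_le _) (by omega) hu.1),
        fun h => hu.2 (Or.inl (hanti (by omega) le_rfl (hEL h)))⟩
      rw [IsIsland] at h1
      push Not at h1
      obtain ⟨v, hv⟩ := h1 (hMne r hr)
      exact ⟨v, fun _ => hv⟩
    · exact ⟨(hMne 0 (by omega)).choose, fun h => absurd h hr⟩
  choose v hv using hMv
  have hvE : ∀ r < Q, v r ∈ E (6 * r) := fun r hr => (hv r hr).1.1
  have hvU : ∀ r < Q, v r ∉ E (6 * r + 3) ∪ C (6 * r + 3) := fun r hr => (hv r hr).1.2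
  have hnbr : ∀ r < Q, ∃ s, s < 2 * Q ∧ (∀ p, Seg s p ⊆ B r p) ∧
      G.neighborSet (v r) \ M r ⊆ Z ∪ C (3 * s) := by
    intro r hr
    have hvZ := hEZ (by omega) (hvE r hr)
    have h1 : ∀ y ∈ G.neighborSet (v r) \ M r, y ∉ Z → y ∈ C (6 * r) ∨
        (y ∈ E (6 * r) ∧ y ∈ C (6 * r + 3)) := by
      rintro y ⟨hy, hyM⟩ hyZ
      by_cases hyE : y ∈ E (6 * r)
      · refine Or.inr ⟨hyE, ?_⟩
        by_contra hyC
        refine hyM ⟨hyE, fun h => ?_⟩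
        have h2 := h.resolve_right hyC
        exact hvU r hr (Or.inr ⟨⟨fun h => hvU r hr (Or.inl h), y, h2, hy.symm⟩, hvZ⟩)
      · exact Or.inl ⟨⟨hyE, v r, hvE r hr, hy⟩, hyZ⟩
    by_cases hv1 : v r ∈ E (6 * r + 1)
    · refine ⟨2 * r + 1, by omega, fun p => Set.subset_union_right, fun y hy => ?_⟩
      by_cases hyZ : y ∈ Z
      · exact Or.inl hyZ
      rcases h1 y hy hyZ with h | h
      · refine absurd ?_ (hCC (Nat.lt_succ_self (6 * r)) (by omega) h)
        exact ⟨⟨fun h' => h.1.1 (hanti (by omega) (by omega) h'), v r, hv1, hy.1⟩, hyZ⟩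
      · rw [show 3 * (2 * r + 1) = 6 * r + 3 by omega]
        exact Or.inr h.2
    · refine ⟨2 * r, by omega, fun p => Set.subset_union_left, fun y hy => ?_⟩
      by_cases hyZ : y ∈ Z
      · exact Or.inl hyZ
      rcases h1 y hy hyZ with h | h
      · rw [show 3 * (2 * r) = 6 * r by omega]
        exact Or.inr h
      · have h2 : ∀ i, i = 6 * r + 1 ∨ i = 6 * r + 2 → y ∈ E i := by
          intro i hi
          by_contra hyi
          obtain ⟨⟨-, x, hx, hxy⟩, -⟩ := h.2
          exact hCC (show i < 6 * r + 3 by omega) (by omega)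
            ⟨⟨hyi, x, hanti (by omega) (by omega) hx, hxy⟩, hyZ⟩ h.2
        refine absurd ?_ (hCC (Nat.lt_succ_self (6 * r + 1)) (by omega)
          (show v r ∈ C (6 * r + 1) from ⟨⟨hv1, y, h2 _ (Or.inl rfl), hy.1.symm⟩, hvZ⟩))
        exact ⟨⟨fun h => hv1 (hanti (by omega) (by omega) h), y, h2 _ (Or.inr rfl), hy.1.symm⟩,
          hvZ⟩
  refine isMinorOf_of_strands (K := 2 * k) (Q := Q) (Z := Z) (P := C 0)
    (Set.toFinite (Z ∪ C 0)).toFinset (fun l => by simp) ?_ (Nat.lt_succ_self _) ?_ B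
    ?_ ?_ ?_ ?_ v ?_ ?_ ?_ ?_
  · rw [← Set.ncard_eq_toFinset_card]
    have h1 := Set.ncard_union_le Z (C 0)
    have h2 := hEk 0 (Nat.zero_le _)
    simp only [hC] at h1 ⊢
    omega
  · rw [Set.disjoint_left]
    exact fun u hu hu' => hu'.2 hu
  · intro r hr p hp
    obtain ⟨h1, h2, -, u, hu, h3⟩ := hSegspec (2 * r) (by omega) p hp
    obtain ⟨h4, h5, -, -⟩ := hSegspec (2 * r + 1) (by omega) p hp
    exact connected_induce_union h2.preconnected h5.preconnected hu h4 h3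
  · intro r hr p hp
    obtain ⟨-, -, -, u, hu, h1⟩ := hSegspec (2 * r + 1) (by omega) p hp
    exact ⟨u, Or.inr hu, _, Or.inl (hSegspec (2 * (r + 1)) (by omega) p hp).1, h1⟩
  · intro r hr s hs p hp p' hp' hne
    simp only [hB, Set.disjoint_union_left, Set.disjoint_union_right]
    refine ⟨⟨?_, ?_⟩, ?_, ?_⟩ <;>
      first
      | exact hSegdisj _ (by omega) _ (by omega) p hp p' hp' (Or.inl (by omega))
      | exact hSegdisj _ (by omega) _ (by omega) p hp p' hp' (hne.imp_left fun h => by omega)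
  · intro r hr p hp
    rw [Set.disjoint_left]
    exact fun u hu hu' => hUZ (by omega) (hBsub r hr p hp hu').1 hu
  · exact fun r hr => hEZ (by omega) (hvE r hr)
  · have h1 : ∀ r s, r < s → s < Q → v r ≠ v s := fun r s hrs hs h =>
      hvU r (by omega) (Or.inl (h ▸ hanti (by omega) (by omega) (hvE s hs)))
    intro r hr s hs h
    rcases lt_trichotomy r s with h2 | h2 | h2
    · exact absurd h (h1 r s h2 hs)
    · exact h2
    · exact absurd h.symm (h1 s r h2 hr)
  · intro r hr s hs p hp h
    have h1 := hBsub s hs p hp h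
    rcases lt_trichotomy r s with h2 | h2 | h2
    · exact absurd (hUanti (by omega) (by omega) h1.1) (hvU r hr)
    · exact h2
    · exact absurd (Or.inl (hanti (by omega) (by omega) (hvE r hr))) h1.2
  · intro r hr
    obtain ⟨s, hs, hsB, hsN⟩ := hnbr r hr
    set N : Finset V := (Set.toFinite (Z ∪ C 0)).toFinset.filter fun l =>
      (l ∈ Z ∧ G.Adj (v r) l) ∨ (l ∈ C 0 ∧ ∃ u ∈ B r l, G.Adj (v r) u) with hN
    have hNt : t ≤ N.card := by
      refine (hv r hr).2.trans ?_
      rw [← Set.ncard_coe_finset N]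
      refine (Set.ncard_le_ncard (t := (fun l => if l ∈ Z then l else c s l) '' (N : Set V)) ?_
        (Set.toFinite _)).trans (Set.ncard_image_le (Set.toFinite _))
      intro y hy
      have hadj : G.Adj (v r) y := hy.1
      rcases hsN hy with h | h
      · refine ⟨y, ?_, if_pos h⟩
        simp [hN, h, hadj]
      · obtain ⟨l, hl, rfl⟩ := (hcbij s hs.le).surjOn h
        refine ⟨l, ?_, if_neg hl.2⟩
        have h1 : ∃ u ∈ B r l, G.Adj (v r) u := ⟨_, hsB l (hSegspec s hs l hl).1, hadj⟩
        simp only [hN, Finset.coe_filter, Set.Finite.mem_toFinset]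
        exact ⟨Or.inr hl, Or.inr ⟨hl, h1⟩⟩
    obtain ⟨N', hN', hN't⟩ := Finset.exists_subset_card_eq hNt
    refine ⟨N', hN'.trans (Finset.filter_subset _ _), hN't, fun l hl => ?_⟩
    exact (Finset.mem_filter.1 (hN' hl)).2

/-- Vertex sets assembled from the empty set by repeatedly taking disjoint unions of two such
sets and at most `k` further vertices, always with at most `k` boundary vertices. -/
inductive Assembled {V : Type*} (G : SimpleGraph V) (k : ℕ) : Set V → Prop
  | empty : Assembled G k ∅
  | node (D₁ D₂ R : Set V) : Assembled G k D₁ → Assembled G k D₂ → Disjoint D₁ D₂ →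
      Disjoint (D₁ ∪ D₂) R → R.ncard ≤ k → (outerBoundary G (D₁ ∪ D₂ ∪ R)).ncard ≤ k →
      Assembled G k (D₁ ∪ D₂ ∪ R)

/-- A tree decomposition with bags `β` of what remains of `G` after the assembled sets `acc x`,
attached at the nodes `x` of the tree, are removed. -/
structure IsPartialDecomposition {V ι : Type*} (G : SimpleGraph V) (k : ℕ) (T : SimpleGraph ι)
    (β acc : ι → Set V) : Prop where
  assembled : ∀ x, Assembled G k (acc x)
  pairwise_disjoint : ∀ x y, x ≠ y → Disjoint (acc x) (acc y)
  disjoint_bag : ∀ x y, Disjoint (acc x) (β y)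
  outerBoundary_subset : ∀ x, outerBoundary G (acc x) ⊆ β x
  ncard_bag_le : ∀ x, (β x).ncard ≤ k
  adj_bag : ∀ u v, G.Adj u v → (∀ x, u ∉ acc x) → (∀ x, v ∉ acc x) → ∃ x, u ∈ β x ∧ v ∈ β x
  connected : ∀ v, (∀ x, v ∉ acc x) → (T.induce {x | v ∈ β x}).Connected

theorem reachable_of_forall_adj {V W : Type*} {G : SimpleGraph V} {H : SimpleGraph W} {f : V → W}
    (h : ∀ a b, G.Adj a b → H.Reachable (f a) (f b)) {a b : V} (hab : G.Reachable a b) :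
    H.Reachable (f a) (f b) := by
  obtain ⟨p⟩ := hab
  induction p with
  | nil => exact Reachable.refl _
  | cons hadj _ ih => exact (h _ _ hadj).trans ih

theorem IsPartialDecomposition.mem_of_leaf {V ι : Type*} {G : SimpleGraph V} {k : ℕ}
    {T : SimpleGraph ι} {β acc : ι → Set V} (h : IsPartialDecomposition G k T β acc) {l p : ι}
    (hp : ∀ y, T.Adj l y → y = p) {v : V} (hv : ∀ x, v ∉ acc x) (hvl : v ∈ β l) {x : ι}
    (hx : x ≠ l) (hvx : v ∈ β x) : v ∈ β p := by
  obtain ⟨q⟩ := (h.connected v hv).preconnected ⟨l, hvl⟩ ⟨x, hvx⟩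
  cases q with
  | nil => exact absurd rfl hx
  | @cons _ c _ hadj _ =>
    have := hp c hadj
    exact this ▸ c.2

theorem IsPartialDecomposition.outerBoundary_union_subset {V ι : Type*} {G : SimpleGraph V}
    {k : ℕ} {T : SimpleGraph ι} {β acc : ι → Set V} (h : IsPartialDecomposition G k T β acc)
    {l p : ι} (hp : ∀ y, T.Adj l y → y = p) :
    outerBoundary G (acc p ∪ acc l ∪ (β l \ β p)) ⊆ β p := by
  rintro u ⟨hu, v, hv, hvu⟩
  simp only [Set.mem_union, Set.mem_sdiff, not_or, not_and, not_not] at hu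
  obtain ⟨⟨hup, hul⟩, hubag⟩ := hu
  rcases hv with (hv | hv) | ⟨hvl, hvp⟩
  · exact h.outerBoundary_subset p ⟨hup, v, hv, hvu⟩
  · exact hubag (h.outerBoundary_subset l ⟨hul, v, hv, hvu⟩)
  · have hvacc : ∀ x, v ∉ acc x := fun x hx => Set.disjoint_left.1 (h.disjoint_bag x l) hx hvl
    have hnot : ∀ x, v ∈ β x → x = l := fun x hx => by
      by_contra hne
      exact hvp (h.mem_of_leaf hp hvacc hvl hne hx)
    by_cases huacc : ∃ x, u ∈ acc x
    · obtain ⟨x, hx⟩ := huacc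
      have := hnot x (h.outerBoundary_subset x ⟨hvacc x, u, hx, hvu.symm⟩)
      exact absurd (this ▸ hx) hul
    · push Not at huacc
      obtain ⟨x, hvx, hux⟩ := h.adj_bag v u hvu hvacc huacc
      exact hubag (hnot x hvx ▸ hux)

theorem IsPartialDecomposition.remove_leaf {V ι : Type*} [Finite V] {G : SimpleGraph V} {k : ℕ}
    {T : SimpleGraph ι} {β acc : ι → Set V} (h : IsPartialDecomposition G k T β acc) {l p : ι}
    (hlp : T.Adj l p) (hp : ∀ y, T.Adj l y → y = p) :
    ∃ acc' : ι → Set V, IsPartialDecomposition G k (T.induce {l}ᶜ) (fun x => β x)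
      (fun x => acc' x) := by
  classical
  have hpl : p ≠ l := hlp.ne'
  set A := acc p ∪ acc l ∪ (β l \ β p) with hA
  set acc' : ι → Set V := fun x => if x = p then A else acc x with hacc'
  have haccp : acc' p = A := if_pos rfl
  have haccne : ∀ x, x ≠ p → acc' x = acc x := fun x hx => if_neg hx
  have hbdy : outerBoundary G A ⊆ β p := h.outerBoundary_union_subset hp
  have hAne : ∀ x, x ≠ p → x ≠ l → Disjoint (acc x) A := by
    intro x hxp hxl
    simp only [hA, Set.disjoint_union_right]
    exact ⟨⟨h.pairwise_disjoint x p hxp, h.pairwise_disjoint x l hxl⟩,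
      (h.disjoint_bag x l).mono_right Set.sdiff_subset⟩
  have hnotin : ∀ u, (∀ x : ({l}ᶜ : Set ι), u ∉ acc' x) →
      (∀ x, u ∉ acc x) ∧ (u ∈ β l → u ∈ β p) := by
    intro u hu
    have hup : u ∉ A := haccp ▸ hu ⟨p, hpl⟩
    simp only [hA, Set.mem_union, Set.mem_sdiff, not_or, not_and, not_not] at hup
    refine ⟨fun x => ?_, hup.2⟩
    by_cases hxp : x = p
    · exact hxp ▸ hup.1.1
    by_cases hxl : x = l
    · exact hxl ▸ hup.1.2
    · exact haccne x hxp ▸ hu ⟨x, hxl⟩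
  refine ⟨acc', ?_, ?_, ?_, ?_, fun x => h.ncard_bag_le x, ?_, ?_⟩
  · rintro ⟨x, hx⟩
    by_cases hxp : x = p
    · subst hxp
      change Assembled G k (acc' x)
      rw [haccp]
      refine Assembled.node _ _ _ (h.assembled x) (h.assembled l) (h.pairwise_disjoint _ _ hx)
        (Set.disjoint_union_left.2 ⟨(h.disjoint_bag x l).mono_right Set.sdiff_subset,
          (h.disjoint_bag l l).mono_right Set.sdiff_subset⟩)
        ((Set.ncard_le_ncard Set.sdiff_subset (Set.toFinite _)).trans (h.ncard_bag_le l))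
        ((Set.ncard_le_ncard hbdy (Set.toFinite _)).trans (h.ncard_bag_le x))
    · change Assembled G k (acc' x)
      rw [haccne x hxp]
      exact h.assembled x
  · rintro ⟨x, hx⟩ ⟨y, hy⟩ hxy
    have hxy' : x ≠ y := fun h => hxy (Subtype.ext h)
    change Disjoint (acc' x) (acc' y)
    by_cases hxp : x = p
    · rw [haccne y (fun h => hxy' (hxp.trans h.symm)), hxp, haccp]
      exact (hAne y (fun h => hxy' (hxp.trans h.symm)) hy).symm
    · rw [haccne x hxp]
      by_cases hyp : y = p
      · rw [hyp, haccp]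
        exact hAne x hxp hx
      · rw [haccne y hyp]
        exact h.pairwise_disjoint x y hxy'
  · rintro ⟨x, hx⟩ ⟨y, hy⟩
    change Disjoint (acc' x) (β y)
    by_cases hxp : x = p
    · rw [hxp, haccp, hA, Set.disjoint_union_left, Set.disjoint_union_left]
      refine ⟨⟨h.disjoint_bag p y, h.disjoint_bag l y⟩, Set.disjoint_left.2 ?_⟩
      rintro v ⟨hvl, hvp⟩ hvy
      exact hvp (h.mem_of_leaf hp
        (fun x hx => Set.disjoint_left.1 (h.disjoint_bag x l) hx hvl) hvl hy hvy)
    · rw [haccne x hxp]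
      exact h.disjoint_bag x y
  · rintro ⟨x, hx⟩
    change outerBoundary G (acc' x) ⊆ β x
    by_cases hxp : x = p
    · rw [hxp, haccp]
      exact hbdy
    · rw [haccne x hxp]
      exact h.outerBoundary_subset x
  · intro u v huv hu hv
    obtain ⟨hu1, hu2⟩ := hnotin u hu
    obtain ⟨hv1, hv2⟩ := hnotin v hv
    obtain ⟨x, hux, hvx⟩ := h.adj_bag u v huv hu1 hv1
    by_cases hxl : x = l
    · subst hxl
      exact ⟨⟨p, hpl⟩, hu2 hux, hv2 hvx⟩
    · exact ⟨⟨x, hxl⟩, hux, hvx⟩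
  · intro v hv
    obtain ⟨hv1, hv2⟩ := hnotin v hv
    have hc := h.connected v hv1
    set r : ι → ι := fun x => if x = l then p else x with hr
    have hrl : r l = p := if_pos rfl
    have hrne : ∀ x, x ≠ l → r x = x := fun x hx => if_neg hx
    have hrS : ∀ x, v ∈ β x → r x ∈ ({l}ᶜ : Set ι) ∧ v ∈ β (r x) := by
      intro x hx
      by_cases hxl : x = l
      · rw [hxl, hrl]
        exact ⟨hpl, hv2 (hxl ▸ hx)⟩
      · rw [hrne x hxl]
        exact ⟨hxl, hx⟩
    set f : {x | v ∈ β x} → {x : ({l}ᶜ : Set ι) | v ∈ β x} := fun x =>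
      ⟨⟨r x, (hrS x x.2).1⟩, (hrS x x.2).2⟩ with hf
    have hfadj : ∀ a b, (T.induce {x | v ∈ β x}).Adj a b →
        ((T.induce {l}ᶜ).induce {x : ({l}ᶜ : Set ι) | v ∈ β x}).Reachable (f a) (f b) := by
      rintro ⟨a, ha⟩ ⟨b, hb⟩ hab
      replace hab : T.Adj a b := hab
      have heq : r a = r b ∨ T.Adj (r a) (r b) := by
        by_cases hal : a = l
        · left
          rw [hal] at hab ⊢
          rw [hp b hab, hrl, hrne p hpl]
        by_cases hbl : b = l
        · left
          rw [hbl] at hab ⊢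
          rw [hp a hab.symm, hrl, hrne p hpl]
        · right
          rwa [hrne a hal, hrne b hbl]
      rcases heq with h1 | h1
      · have : f ⟨a, ha⟩ = f ⟨b, hb⟩ := Subtype.ext (Subtype.ext h1)
        rw [this]
      · exact Adj.reachable h1
    have hfid : ∀ x : {x : ({l}ᶜ : Set ι) | v ∈ β x}, f ⟨x, x.2⟩ = x := fun x =>
      Subtype.ext (Subtype.ext (hrne x x.1.2))
    obtain ⟨x0⟩ := hc.nonempty
    have : Nonempty {x : ({l}ᶜ : Set ι) | v ∈ β x} := ⟨f x0⟩
    refine ⟨fun x y => ?_⟩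
    rw [← hfid x, ← hfid y]
    exact reachable_of_forall_adj hfadj (hc.preconnected _ _)

theorem IsPartialDecomposition.assembled_univ {V : Type*} [Finite V] {G : SimpleGraph V} {k : ℕ} :
    ∀ (N : ℕ) {ι : Type*} [Finite ι] {T : SimpleGraph ι} {β acc : ι → Set V}, Nat.card ι ≤ N →
      T.IsTree → IsPartialDecomposition G k T β acc → Assembled G k Set.univ := by
  classical
  intro N
  induction N with
  | zero =>
    intro ι _ T β acc hN hT h
    have := hT.nonempty
    have := Nat.card_pos (α := ι)
    omega
  | succ N ih =>
    intro ι _ T β acc hN hT h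
    cases nonempty_fintype ι
    rcases subsingleton_or_nontrivial ι with hs | hs
    · obtain ⟨r⟩ := hT.nonempty
      have huniv : (Set.univ : Set V) = acc r ∪ ∅ ∪ β r := by
        symm
        rw [Set.eq_univ_iff_forall]
        intro v
        by_cases hv : v ∈ acc r
        · exact Or.inl (Or.inl hv)
        · obtain ⟨x, hx⟩ := (h.connected v (fun x => Subsingleton.elim r x ▸ hv)).nonempty
          exact Or.inr (Subsingleton.elim x r ▸ hx)
      have hb : outerBoundary G (acc r ∪ ∅ ∪ β r) = ∅ := by
        rw [← huniv]
        exact Set.eq_empty_of_forall_notMem fun u hu => hu.1 trivial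
      rw [huniv]
      exact Assembled.node _ _ _ (h.assembled r) Assembled.empty (Set.disjoint_empty _)
        (by simpa using h.disjoint_bag r r) (h.ncard_bag_le r) (by rw [hb]; simp)
    · obtain ⟨l, hl⟩ := hT.exists_vert_degree_one_of_nontrivial
      obtain ⟨p, hlp, hp⟩ := degree_eq_one_iff_existsUnique_adj.1 hl
      obtain ⟨acc', h'⟩ := h.remove_leaf hlp hp
      refine ih ?_ ⟨hT.connected.induce_compl_singleton_of_degree_eq_one hl,
        hT.isAcyclic.induce _⟩ h'
      have h1 : Nat.card ({l}ᶜ : Set ι) < Nat.card ι := by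
        rw [Nat.card_coe_set_eq, ← Set.ncard_univ]
        refine Set.ncard_lt_ncard ?_ (Set.toFinite _)
        rw [Set.ssubset_univ_iff]
        intro h
        exact (h ▸ Set.mem_univ l : l ∈ ({l}ᶜ : Set ι)) rfl
      omega

theorem HasTreewidthAtMost.assembled_univ {V : Type*} [Finite V] {G : SimpleGraph V} {w : ℕ}
    (h : HasTreewidthAtMost G w) : Assembled G (w + 1) Set.univ := by
  obtain ⟨n, T, β, hT, hadj, hconn, hcard⟩ := h
  refine IsPartialDecomposition.assembled_univ (Nat.card (Fin n)) (acc := fun _ => ∅) le_rfl hT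
    (⟨fun _ => Assembled.empty, fun _ _ _ => Set.disjoint_empty _, fun _ _ => Set.empty_disjoint _,
      fun x u hu => ?_, hcard, fun u v huv _ _ => hadj huv, fun v _ => hconn v⟩ :
      IsPartialDecomposition G (w + 1) T β fun _ => ∅)
  obtain ⟨-, v, hv, -⟩ := hu
  exact hv.elim

/-- There is a strictly decreasing sequence of `j + 1` sets with at most `k` boundary vertices each
that starts with `D` and ends with `D'`. -/
def HasChain {V : Type*} (G : SimpleGraph V) (k : ℕ) (D D' : Set V) (j : ℕ) : Prop :=
  ∃ E : ℕ → Set V, E 0 = D ∧ E j = D' ∧ StrictAntiOn E (Set.Iic j) ∧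
    ∀ i ≤ j, (outerBoundary G (E i)).ncard ≤ k

theorem HasChain.refl {V : Type*} {G : SimpleGraph V} {k : ℕ} {D : Set V}
    (h : (outerBoundary G D).ncard ≤ k) : HasChain G k D D 0 := by
  refine ⟨fun _ => D, rfl, rfl, fun i hi j hj hij => ?_, fun _ _ => h⟩
  simp only [Set.mem_Iic] at hj
  omega

theorem HasChain.cons {V : Type*} {G : SimpleGraph V} {k j : ℕ} {D D₁ D' : Set V}
    (h : HasChain G k D₁ D' j) (hD : D₁ ⊂ D) (hk : (outerBoundary G D).ncard ≤ k) :
    HasChain G k D D' (j + 1) := by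
  obtain ⟨E, rfl, hj, hE, hEk⟩ := h
  refine ⟨fun i => Nat.casesOn i D E, rfl, hj, ?_, ?_⟩
  · rintro (_ | i) hi (_ | l) hl hil
    · exact absurd hil (lt_irrefl _)
    · simp only [Set.mem_Iic] at hl
      refine (?_ : E l ⊆ E 0).trans_ssubset hD
      exact hE.antitoneOn (Set.mem_Iic.2 (Nat.zero_le _)) (Set.mem_Iic.2 (by omega))
        (Nat.zero_le _)
    · omega
    · simp only [Set.mem_Iic] at hl
      exact hE (Set.mem_Iic.2 (by omega)) (Set.mem_Iic.2 (by omega)) (by omega)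
  · rintro (_ | i) hi
    · exact hk
    · exact hEk i (by omega)

theorem HasChain.subset {V : Type*} {G : SimpleGraph V} {k j : ℕ} {D D' : Set V}
    (h : HasChain G k D D' j) : D' ⊆ D := by
  obtain ⟨E, rfl, rfl, hE, -⟩ := h
  exact hE.antitoneOn (Set.mem_Iic.2 (Nat.zero_le _)) (Set.mem_Iic.2 le_rfl) (Nat.zero_le _)

/-- `D` contains `ν` pairwise disjoint `t`-islands. -/
def HasIslandsIn {V : Type*} (G : SimpleGraph V) (t ν : ℕ) (D : Set V) : Prop :=
  ∃ f : Fin ν → Set V, (∀ i, IsIsland G t (f i) ∧ f i ⊆ D) ∧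
    Pairwise (Function.onFun Disjoint f)

theorem HasIslandsIn.mono {V : Type*} {G : SimpleGraph V} {t ν : ℕ} {D D' : Set V}
    (h : HasIslandsIn G t ν D) (hD : D ⊆ D') : HasIslandsIn G t ν D' := by
  obtain ⟨f, hf, hf'⟩ := h
  exact ⟨f, fun i => ⟨(hf i).1, (hf i).2.trans hD⟩, hf'⟩

theorem IsIsland.hasIslandsIn {V : Type*} {G : SimpleGraph V} {t : ℕ} {S D : Set V}
    (h : IsIsland G t S) (hD : S ⊆ D) : HasIslandsIn G t 1 D :=
  ⟨fun _ => S, fun _ => ⟨h, hD⟩, fun i j hij => absurd (Subsingleton.elim i j) hij⟩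

theorem HasIslandsIn.add {V : Type*} {G : SimpleGraph V} {t ν ν' : ℕ} {D D' : Set V}
    (h : HasIslandsIn G t ν D) (h' : HasIslandsIn G t ν' D') (hD : Disjoint D D') :
    HasIslandsIn G t (ν + ν') (D ∪ D') := by
  obtain ⟨f, hf, hfd⟩ := h
  obtain ⟨g, hg, hgd⟩ := h'
  refine ⟨Fin.addCases f g, fun i => ?_, fun i j => ?_⟩
  · refine Fin.addCases (fun i => ?_) (fun i => ?_) i
    · simpa using ⟨(hf i).1, (hf i).2.trans Set.subset_union_left⟩
    · simpa using ⟨(hg i).1, (hg i).2.trans Set.subset_union_right⟩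
  · refine Fin.addCases (fun i => ?_) (fun i => ?_) i <;>
      refine Fin.addCases (fun j => ?_) (fun j => ?_) j <;> intro hij <;>
      simp only [Function.onFun, Fin.addCases_left, Fin.addCases_right]
    · exact hfd fun h => hij (by rw [h])
    · exact hD.mono (hf i).2 (hg j).2
    · exact (hD.mono (hf j).2 (hg i).2).symm
    · exact hgd fun h => hij (by rw [h])

/-- If long chains of sets with small boundary capture islands, then an assembled set is either
small or contains a number of disjoint islands linear in its size. -/
theorem Assembled.small_or_hasIslandsIn {V : Type*} [Finite V] {G : SimpleGraph V} {t k L c A : ℕ}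
    (hc : c = k * 2 ^ L + k) (hA : 2 * (L * c) + c ≤ A)
    (hL : ∀ D D' : Set V, HasChain G k D D' L → ∃ S ⊆ D \ D', IsIsland G t S) {D : Set V}
    (hD : Assembled G k D) :
    (∃ h < L, HasChain G k D ∅ h ∧ D.ncard + k ≤ k * 2 ^ h) ∨
    ∃ ν D' j, j < L ∧ HasChain G k D D' j ∧ HasIslandsIn G t ν D' ∧
      D.ncard + A ≤ 2 * A * ν + j * c := by
  have hL0 : 0 < L := by
    by_contra h0
    obtain rfl : L = 0 := by omega
    obtain ⟨S, hS, hisl⟩ := hL ∅ ∅ (HasChain.refl (by simp [outerBoundary]))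
    obtain ⟨v, hv⟩ := hisl.1
    exact (hS hv).1.elim
  have hpow : ∀ {h}, h ≤ L → k * 2 ^ h ≤ k * 2 ^ L := fun {h} hh =>
    Nat.mul_le_mul_left k (Nat.pow_le_pow_right (by norm_num) hh)
  have hjc : ∀ {j}, j ≤ L → j * c ≤ L * c := fun {j} hj => Nat.mul_le_mul_right c hj
  induction hD with
  | empty =>
    exact Or.inl ⟨0, hL0, HasChain.refl (by simp [outerBoundary]), by simp⟩
  | node D₁ D₂ R h₁ h₂ hdisj hR hRk hk ih₁ ih₂ =>
    set D := D₁ ∪ D₂ ∪ R with hD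
    have hsub₁ : D₁ ⊆ D := Set.subset_union_left.trans Set.subset_union_left
    have hsub₂ : D₂ ⊆ D := Set.subset_union_right.trans Set.subset_union_left
    have hcard : D.ncard ≤ D₁.ncard + D₂.ncard + k := by
      have h1 : D.ncard ≤ _ := Set.ncard_union_le (D₁ ∪ D₂) R
      have h2 := Set.ncard_union_le D₁ D₂
      omega
    have hsmall : ∀ (X Y : Set V) (h h' : ℕ), X ⊆ D → h' ≤ h → h < L → D.ncard ≤ X.ncard + Y.ncard + k →
        HasChain G k X ∅ h → X.ncard + k ≤ k * 2 ^ h → Y.ncard + k ≤ k * 2 ^ h' →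
        (∃ h < L, HasChain G k D ∅ h ∧ D.ncard + k ≤ k * 2 ^ h) ∨
        ∃ ν D' j, j < L ∧ HasChain G k D D' j ∧ HasIslandsIn G t ν D' ∧
          D.ncard + A ≤ 2 * A * ν + j * c := by
      intro X Y h h' hX hh hhL hXY hchain hXk hYk
      rcases hX.eq_or_ssubset with rfl | hss
      · exact Or.inl ⟨h, hhL, hchain, hXk⟩
      have h1 := hchain.cons hss hk
      have h2 : k * 2 ^ h' ≤ k * 2 ^ h :=
        Nat.mul_le_mul_left k (Nat.pow_le_pow_right (by norm_num) hh)
      have h3 : k * 2 ^ (h + 1) = k * 2 ^ h + k * 2 ^ h := by ring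
      rcases Nat.lt_or_ge (h + 1) L with h4 | h4
      · exact Or.inl ⟨h + 1, h4, h1, by omega⟩
      · obtain rfl : h + 1 = L := by omega
        obtain ⟨S, hS, hisl⟩ := hL _ _ h1
        refine Or.inr ⟨1, D, 0, hL0, HasChain.refl hk,
          hisl.hasIslandsIn (hS.trans Set.sdiff_subset), ?_⟩
        omega
    have hmixed : ∀ (X Y : Set V) (h ν : ℕ) (X' : Set V) (j : ℕ), X ⊆ D → h < L →
        D.ncard ≤ X.ncard + Y.ncard + k →
        Y.ncard + k ≤ k * 2 ^ h → j < L → HasChain G k X X' j → HasIslandsIn G t ν X' →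
        X.ncard + A ≤ 2 * A * ν + j * c →
        ∃ ν D' j, j < L ∧ HasChain G k D D' j ∧ HasIslandsIn G t ν D' ∧
          D.ncard + A ≤ 2 * A * ν + j * c := by
      intro X Y h ν X' j hX hhL hXY hYk hjL hchain hisl hXA
      rcases hX.eq_or_ssubset with rfl | hss
      · exact ⟨ν, X', j, hjL, hchain, hisl, hXA⟩
      have h1 := hchain.cons hss hk
      have h2 := hpow hhL.le
      have h3 : (j + 1) * c = j * c + c := by ring
      rcases Nat.lt_or_ge (j + 1) L with h4 | h4
      · exact ⟨ν, X', j + 1, h4, h1, hisl, by omega⟩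
      · have h5 := hjc (j := j + 1) (by omega)
        obtain rfl : j + 1 = L := by omega
        obtain ⟨S, hS, hS'⟩ := hL _ _ h1
        refine ⟨ν + 1, D, 0, hL0, HasChain.refl hk,
          (hisl.add (hS'.hasIslandsIn hS) disjoint_sdiff_self_right).mono
            (Set.union_subset (hchain.subset.trans hX) Set.sdiff_subset), ?_⟩
        have h6 : 2 * A * (ν + 1) = 2 * A * ν + 2 * A := by ring
        omega
    rcases ih₁ with ⟨h, hhL, hch, hDk⟩ | ⟨ν, X, j, hjL, hch, hisl, hDA⟩ <;>
      rcases ih₂ with ⟨h', hhL', hch', hDk'⟩ | ⟨ν', X', j', hjL', hch', hisl', hDA'⟩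
    · rcases le_total h' h with hle | hle
      · exact hsmall D₁ D₂ h h' hsub₁ hle hhL hcard hch hDk hDk'
      · exact hsmall D₂ D₁ h' h hsub₂ hle hhL' (by omega) hch' hDk' hDk
    · exact Or.inr (hmixed D₂ D₁ h ν' X' j' hsub₂ hhL (by omega) hDk hjL' hch' hisl' hDA')
    · exact Or.inr (hmixed D₁ D₂ h' ν X j hsub₁ hhL' hcard hDk' hjL hch hisl hDA)
    · refine Or.inr ⟨ν + ν', D, 0, hL0, HasChain.refl hk,
        (hisl.add hisl' (hdisj.mono hch.subset hch'.subset)).mono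
          (Set.union_subset (hch.subset.trans hsub₁) (hch'.subset.trans hsub₂)), ?_⟩
      have h1 := hjc hjL.le
      have h2 := hjc hjL'.le
      have h3 : 2 * A * (ν + ν') = 2 * A * ν + 2 * A * ν' := by ring
      omega

/-- Graphs of bounded treewidth without the two unavoidable minors have linearly many disjoint
`t`-islands. -/
theorem exists_pos_hasDisjointIslands (w t m : ℕ) (ht : 1 ≤ t) : ∃ ε : ℝ, 0 < ε ∧
    ∀ (n : ℕ) (G : SimpleGraph (Fin n)), HasTreewidthAtMost G w →
      ¬ IsMinorOf (completeBipartiteGraph (Fin t) (Fin m)) G →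
      ¬ IsMinorOf (IplusP (t - 1) m) G → ∃ k : ℕ, ε * n ≤ (k : ℝ) ∧ HasDisjointIslands G t k := by
  obtain ⟨L, hL⟩ := exists_length_forall_isMinorOf t m (w + 1)
  set k := w + 1 with hk
  set c := k * 2 ^ L + k with hc
  set A := 2 * (L * c) + c with hA
  have hA0 : (0 : ℝ) < 2 * A := by
    have : 0 < A := by omega
    positivity
  refine ⟨1 / (2 * A), by positivity, fun n G hG hK hI => ?_⟩
  have key : ∀ ν : ℕ, n ≤ 2 * A * ν → 1 / (2 * (A : ℝ)) * n ≤ (ν : ℝ) := fun ν hν => by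
    rw [one_div_mul_eq_div, div_le_iff₀ hA0]
    have : (n : ℝ) ≤ 2 * A * ν := by exact_mod_cast hν
    linarith
  have hcard : (Set.univ : Set (Fin n)).ncard = n := by simp
  rcases hG.assembled_univ.small_or_hasIslandsIn (t := t) (A := A) hc le_rfl
    (fun D D' ⟨E, h0, hE, h1, h2⟩ => by
    by_contra hno
    push Not at hno
    exact (hL (Fin n) G E h1 h2 (by rw [h0, hE]; exact hno)).elim hK hI)
    with ⟨h, hhL, -, hle⟩ | ⟨ν, X, j, hjL, -, ⟨f, hf, hfd⟩, hle⟩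
  · rcases Nat.eq_zero_or_pos n with rfl | hn
    · exact ⟨0, key 0 (by simp), fun i => i.elim0, fun i => i.elim0, fun i => i.elim0⟩
    · have h1 : k * 2 ^ h ≤ k * 2 ^ L :=
        Nat.mul_le_mul_left k (Nat.pow_le_pow_right (by norm_num) hhL.le)
      refine ⟨1, key 1 (by omega), fun _ => Set.univ, fun _ => ⟨⟨⟨0, hn⟩, trivial⟩, fun v _ => ?_⟩,
        fun i j hij => absurd (Subsingleton.elim i j) hij⟩
      simp
      omega
  · have h1 : j * c ≤ L * c := Nat.mul_le_mul_right c hjL.le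
    exact ⟨ν, key ν (by omega), f, fun i => (hf i).1, hfd⟩

theorem IsIsland.preimage {W V : Type*} [Finite V] {H : SimpleGraph W} {G : SimpleGraph V}
    (e : H ≃g G) {t : ℕ} {S : Set V} (hS : IsIsland G t S) : IsIsland H t (e ⁻¹' S) := by
  obtain ⟨⟨v, hv⟩, hS⟩ := hS
  refine ⟨⟨e.symm v, by simpa using hv⟩, fun u hu => lt_of_le_of_lt ?_ (hS (e u) hu)⟩
  rw [← Set.ncard_image_of_injective _ e.injective]
  refine Set.ncard_le_ncard ?_ (Set.toFinite _)
  rintro _ ⟨y, ⟨hy, hyS⟩, rfl⟩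
  exact ⟨e.map_rel_iff.2 hy, hyS⟩

theorem PercolationActive.map {W V : Type*} {H : SimpleGraph W} {G : SimpleGraph V}
    (e : H ≃g G) {t : ℕ} {A : Set W} {v : W} (h : PercolationActive H t A v) :
    PercolationActive G t (e '' A) (e v) := by
  induction h with
  | base v hv => exact .base _ ⟨v, hv, rfl⟩
  | step v N hN hadj _ ih =>
    refine .step _ (N.map e.toEquiv.toEmbedding) (by simpa using hN) ?_ ?_
    · intro u hu
      obtain ⟨x, hx, rfl⟩ := Finset.mem_map.1 hu
      exact e.map_rel_iff.2 (hadj x hx)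
    · intro u hu
      obtain ⟨x, hx, rfl⟩ := Finset.mem_map.1 hu
      exact ih x hx

theorem Percolates.map {W V : Type*} {H : SimpleGraph W} {G : SimpleGraph V} (e : H ≃g G) {t : ℕ}
    {A : Set W} (h : Percolates H t A) : Percolates G t (e '' A) := fun v => by
  have := (h (e.symm v)).map e
  rwa [e.apply_symm_apply] at this

theorem PercolationActive.notMem_of_isIsland {V : Type*} [Finite V] {G : SimpleGraph V} {t : ℕ}
    {A S : Set V} (hS : IsIsland G t S) (hAS : Disjoint A S) {v : V}
    (h : PercolationActive G t A v) : v ∉ S := by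
  induction h with
  | base v hv => exact Set.disjoint_left.1 hAS hv
  | step v N hN hadj _ ih =>
    intro hv
    have h1 := Set.ncard_le_ncard (s := (N : Set V)) (t := G.neighborSet v \ S)
      (fun u hu => ⟨hadj u hu, ih u hu⟩) (Set.toFinite _)
    rw [Set.ncard_coe_finset] at h1
    have := hS.2 v hv
    omega

theorem MinorClosed.memClass_of_isMinorOf {𝒢 : ∀ n : ℕ, SimpleGraph (Fin n) → Prop}
    (h𝒢 : MinorClosed 𝒢) {n : ℕ} {G : SimpleGraph (Fin n)} (hG : 𝒢 n G) {W : Type*} [Finite W]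
    {H : SimpleGraph W} (h : IsMinorOf H G) : MemClass 𝒢 H := by
  obtain ⟨μ, h1, h2, h3, h4⟩ := h
  set e := Finite.equivFin W
  exact ⟨_, H.comap e.symm, h𝒢.2 G _ hG ⟨fun i => μ (e.symm i), fun i => h1 _, fun i => h2 _,
    fun i j hij => h3 (e.symm.injective.ne hij), fun i j hij => h4 hij⟩,
    ⟨(SimpleGraph.Iso.comap e.symm H).symm⟩⟩

theorem IplusP_adj_inl_inr {n m : ℕ} (i : Fin n) (j : Fin m) :
    (IplusP n m).Adj (Sum.inl i) (Sum.inr j) := by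
  rw [IplusP, SimpleGraph.fromRel_adj]
  exact ⟨by simp, Or.inl (Or.inl ⟨i, j, rfl, rfl⟩)⟩

theorem IplusP_adj_inr_inr {n m : ℕ} {i j : Fin m} (h : (i : ℕ) + 1 = j) :
    (IplusP n m).Adj (Sum.inr i) (Sum.inr j) := by
  rw [IplusP, SimpleGraph.fromRel_adj]
  refine ⟨fun h' => ?_, Or.inl (Or.inr ⟨i, j, rfl, rfl, h⟩)⟩
  rw [Sum.inr.inj h'] at h
  omega

theorem IsIsland.lt_ncard_add_of_inl_mem {n m t : ℕ} {H : SimpleGraph (Fin n ⊕ Fin m)}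
    (hadj : ∀ i j, H.Adj (Sum.inl i) (Sum.inr j)) {S : Set (Fin n ⊕ Fin m)} (hS : IsIsland H t S)
    {i : Fin n} (hi : Sum.inl i ∈ S) : m < S.ncard + t := by
  have h1 := Set.ncard_le_ncard (s := Set.range (Sum.inr : Fin m → Fin n ⊕ Fin m))
    (t := S ∪ H.neighborSet (Sum.inl i) \ S) (by
      rintro _ ⟨j, rfl⟩
      by_cases h : (Sum.inr j : Fin n ⊕ Fin m) ∈ S
      · exact Or.inl h
      · exact Or.inr ⟨hadj i j, h⟩) (Set.toFinite _)
  rw [← Set.image_univ, Set.ncard_image_of_injective _ Sum.inr_injective] at h1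
  have h2 := Set.ncard_union_le S (H.neighborSet (Sum.inl i) \ S)
  have h3 := hS.2 _ hi
  simp only [Set.ncard_univ, Nat.card_fin] at h1
  omega

theorem IsIsland.lt_ncard_add_of_completeBipartiteGraph {t m : ℕ} {S : Set (Fin t ⊕ Fin m)}
    (hS : IsIsland (completeBipartiteGraph (Fin t) (Fin m)) t S) : m < S.ncard + t := by
  by_cases h : ∃ i, Sum.inl i ∈ S
  · obtain ⟨i, hi⟩ := h
    exact hS.lt_ncard_add_of_inl_mem (fun i j => by simp) hi
  · push Not at h
    obtain ⟨x | j, hj⟩ := hS.1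
    · exact absurd hj (h x)
    have h1 := Set.ncard_le_ncard (s := Set.range (Sum.inl : Fin t → Fin t ⊕ Fin m))
      (t := (completeBipartiteGraph (Fin t) (Fin m)).neighborSet (Sum.inr j) \ S) (by
        rintro _ ⟨i, rfl⟩
        exact ⟨by simp, h i⟩) (Set.toFinite _)
    rw [← Set.image_univ, Set.ncard_image_of_injective _ Sum.inl_injective] at h1
    have h2 := hS.2 _ hj
    simp only [Set.ncard_univ, Nat.card_fin] at h1
    omega

theorem IsIsland.lt_ncard_add_of_IplusP {t m : ℕ} (ht : 1 ≤ t) {S : Set (Fin (t - 1) ⊕ Fin m)}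
    (hS : IsIsland (IplusP (t - 1) m) t S) : m < S.ncard + t := by
  by_cases h : ∃ i, Sum.inl i ∈ S
  · obtain ⟨i, hi⟩ := h
    exact hS.lt_ncard_add_of_inl_mem IplusP_adj_inl_inr hi
  · push Not at h
    have hstep : ∀ i j : Fin m, (IplusP (t - 1) m).Adj (Sum.inr i) (Sum.inr j) →
        Sum.inr i ∈ S → Sum.inr j ∈ S := by
      intro i j hij hi
      by_contra hj
      have h1 := Set.ncard_le_ncard
        (s := insert (Sum.inr j) (Set.range (Sum.inl : Fin (t - 1) → Fin (t - 1) ⊕ Fin m)))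
        (t := (IplusP (t - 1) m).neighborSet (Sum.inr i) \ S) (by
          rintro _ (rfl | ⟨l, rfl⟩)
          · exact ⟨hij, hj⟩
          · exact ⟨(IplusP_adj_inl_inr l i).symm, h l⟩) (Set.toFinite _)
      rw [Set.ncard_insert_of_notMem (by simp), ← Set.image_univ,
        Set.ncard_image_of_injective _ Sum.inl_injective] at h1
      have h2 := hS.2 _ hi
      simp only [Set.ncard_univ, Nat.card_fin] at h1
      omega
    obtain ⟨x | j, hj⟩ := hS.1
    · exact absurd hj (h x)
    have hdown : ∀ d : ℕ, ∀ i : Fin m, (i : ℕ) + d = j → Sum.inr i ∈ S := by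
      intro d
      induction d with
      | zero =>
        intro i hi
        rwa [show i = j from Fin.ext hi]
      | succ d ih =>
        intro i hi
        have hlt : (i : ℕ) + 1 < m := by have := j.2; omega
        exact hstep ⟨i + 1, hlt⟩ i (IplusP_adj_inr_inr rfl).symm (ih ⟨i + 1, hlt⟩ (by
          simp only; omega))
    have hup : ∀ d : ℕ, ∀ i : Fin m, (i : ℕ) = j + d → Sum.inr i ∈ S := by
      intro d
      induction d with
      | zero =>
        intro i hi
        rwa [show i = j from Fin.ext hi]
      | succ d ih =>
        intro i hi
        have hlt : (i : ℕ) - 1 < m := by have := i.2; omega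
        exact hstep ⟨i - 1, hlt⟩ i (IplusP_adj_inr_inr (by simp only; omega))
          (ih ⟨i - 1, hlt⟩ (by simp only; omega))
    have h1 := Set.ncard_le_ncard (s := Set.range (Sum.inr : Fin m → Fin (t - 1) ⊕ Fin m))
      (t := S) (by
        rintro _ ⟨i, rfl⟩
        rcases le_total (i : ℕ) j with hij | hij
        · exact hdown (j - i) i (by omega)
        · exact hup (i - j) i (by omega)) (Set.toFinite _)
    rw [← Set.image_univ, Set.ncard_image_of_injective _ Sum.inr_injective] at h1
    simp only [Set.ncard_univ, Nat.card_fin] at h1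
    omega

theorem percolates_completeBipartiteGraph (t m : ℕ) :
    Percolates (completeBipartiteGraph (Fin t) (Fin m)) t (Set.range Sum.inl) := by
  rintro (i | j)
  · exact .base _ ⟨i, rfl⟩
  · refine .step _ (Finset.univ.map ⟨Sum.inl, Sum.inl_injective⟩) (by simp) ?_ ?_
    · simp
    · intro u hu
      obtain ⟨i, -, rfl⟩ := Finset.mem_map.1 hu
      exact .base _ ⟨i, rfl⟩

theorem percolates_IplusP {t m : ℕ} (ht : 1 ≤ t) (hm : 0 < m) :
    Percolates (IplusP (t - 1) m) t (insert (Sum.inr ⟨0, hm⟩) (Set.range Sum.inl)) := by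
  have hinr : ∀ (d : ℕ) (hd : d < m), PercolationActive (IplusP (t - 1) m) t
      (insert (Sum.inr ⟨0, hm⟩) (Set.range Sum.inl)) (Sum.inr ⟨d, hd⟩) := by
    intro d
    induction d with
    | zero => exact fun _ => .base _ (Or.inl rfl)
    | succ d ih =>
      intro hd
      refine .step _ (Finset.cons (Sum.inr ⟨d, by omega⟩)
        (Finset.univ.map ⟨Sum.inl, Sum.inl_injective⟩) (by simp)) ?_ ?_ ?_
      · rw [Finset.card_cons, Finset.card_map, Finset.card_univ, Fintype.card_fin]
        omega
      · intro u hu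
        rcases Finset.mem_cons.1 hu with rfl | hu
        · exact (IplusP_adj_inr_inr rfl).symm
        · obtain ⟨i, -, rfl⟩ := Finset.mem_map.1 hu
          exact (IplusP_adj_inl_inr _ _).symm
      · intro u hu
        rcases Finset.mem_cons.1 hu with rfl | hu
        · exact ih _
        · obtain ⟨i, -, rfl⟩ := Finset.mem_map.1 hu
          exact .base _ (Or.inr ⟨i, rfl⟩)
  rintro (i | ⟨d, hd⟩)
  · exact .base _ (Or.inr ⟨i, rfl⟩)
  · exact hinr d hd

theorem HasDisjointIslands.exists_ncard_mul_le {n t k : ℕ} {G : SimpleGraph (Fin n)}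
    (h : HasDisjointIslands G t k) (hk : 0 < k) : ∃ S, IsIsland G t S ∧ k * S.ncard ≤ n := by
  classical
  obtain ⟨f, hf, hfd⟩ := h
  have : Nonempty (Fin k) := ⟨⟨0, hk⟩⟩
  obtain ⟨i, hi⟩ := Finite.exists_min fun i => (f i).ncard
  refine ⟨f i, hf i, ?_⟩
  have h1 : (Finset.univ.biUnion fun j => (f j).toFinset).card = ∑ j, (f j).toFinset.card :=
    Finset.card_biUnion fun a _ b _ hab => Set.disjoint_toFinset.2 (hfd hab)
  have h2 := Finset.card_le_univ (Finset.univ.biUnion fun j => (f j).toFinset)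
  have h3 : ∑ _j : Fin k, (f i).ncard ≤ ∑ j, (f j).toFinset.card :=
    Finset.sum_le_sum fun j _ => by
      rw [← Set.ncard_eq_toFinset_card']
      exact hi j
  simp only [Finset.sum_const, Finset.card_univ, Fintype.card_fin, smul_eq_mul] at h2 h3
  omega

theorem HasDisjointIslands.le_ncard_of_percolates {n t k : ℕ} {G : SimpleGraph (Fin n)}
    (h : HasDisjointIslands G t k) {A : Set (Fin n)} (hA : Percolates G t A) : k ≤ A.ncard := by
  obtain ⟨f, hf, hfd⟩ := h
  have hmeet : ∀ i, ∃ a ∈ A, a ∈ f i := by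
    intro i
    by_contra! hno
    obtain ⟨v, hv⟩ := (hf i).1
    exact (hA v).notMem_of_isIsland (hf i) (Set.disjoint_left.2 hno) hv
  choose a haA haf using hmeet
  have hinj : Function.Injective a := fun i j hij => by
    by_contra hne
    exact Set.disjoint_left.1 (hfd hne) (haf i) (hij ▸ haf j)
  have h1 := Set.ncard_le_ncard (s := Set.range a) (t := A) (by
    rintro _ ⟨i, rfl⟩
    exact haA i) (Set.toFinite _)
  rw [← Set.image_univ, Set.ncard_image_of_injective _ hinj] at h1
  simpa using h1

theorem exists_isIsland_of_memClass {𝒢 : ∀ n : ℕ, SimpleGraph (Fin n) → Prop} {t C : ℕ}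
    (h : ∀ (n : ℕ) (G : SimpleGraph (Fin n)), 𝒢 n G → 0 < n →
      ∃ S : Set (Fin n), IsIsland G t S ∧ S.ncard ≤ C)
    {W : Type*} [Nonempty W] {H : SimpleGraph W} (hH : MemClass 𝒢 H) :
    ∃ S : Set W, IsIsland H t S ∧ S.ncard ≤ C := by
  obtain ⟨n, G, hG, ⟨e⟩⟩ := hH
  have hn : 0 < n := Fin.pos (e (Classical.arbitrary W))
  obtain ⟨S, hS, hSC⟩ := h n G hG hn
  refine ⟨e ⁻¹' S, hS.preimage e, ?_⟩
  rwa [← Set.ncard_image_of_injective _ e.injective, Set.image_preimage_eq _ e.surjective]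

theorem not_memClass_of_percolates {𝒢 : ∀ n : ℕ, SimpleGraph (Fin n) → Prop} {t : ℕ} {ε : ℝ}
    (h : ∀ (n : ℕ) (G : SimpleGraph (Fin n)), 𝒢 n G → 0 < n →
      ∀ A : Set (Fin n), (A.ncard : ℝ) ≤ ε * n → ¬ Percolates G t A)
    {W : Type*} [Nonempty W] {H : SimpleGraph W} {A : Set W} (hA : Percolates H t A)
    (hAε : (A.ncard : ℝ) ≤ ε * Nat.card W) : ¬ MemClass 𝒢 H := by
  rintro ⟨n, G, hG, ⟨e⟩⟩
  have hn : 0 < n := Fin.pos (e (Classical.arbitrary W))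
  have hcard : Nat.card W = n := by simp [Nat.card_congr e.toEquiv]
  refine h n G hG hn (e '' A) ?_ (hA.map e)
  rwa [Set.ncard_image_of_injective _ e.injective, ← hcard]

/-- for a minor-closed class `𝒢` of bounded treewidth and `t ≥ 1`, the
following are equivalent: (i) exclusion of `K_{t,m}` and `I_{t-1}+P_m` for some `m`,
(ii) uniformly bounded `t`-islands in non-empty members, (iii) linearly many pairwise
disjoint `t`-islands, (iv) uniform resistance to `t`-percolation. -/
theorem stmt13 (𝒢 : ∀ n : ℕ, SimpleGraph (Fin n) → Prop) (hmc : MinorClosed 𝒢)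
    (w : ℕ) (htw : ∀ (n : ℕ) (G : SimpleGraph (Fin n)), 𝒢 n G → HasTreewidthAtMost G w)
    (t : ℕ) (ht : 1 ≤ t) :
    ((∃ m : ℕ, 1 ≤ m ∧ ¬ MemClass 𝒢 (completeBipartiteGraph (Fin t) (Fin m)) ∧
        ¬ MemClass 𝒢 (IplusP (t-1) m)) ↔
      (∃ C : ℕ, 1 ≤ C ∧ ∀ (n : ℕ) (G : SimpleGraph (Fin n)), 𝒢 n G → 0 < n →
        ∃ S : Set (Fin n), IsIsland G t S ∧ S.ncard ≤ C)) ∧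
    ((∃ C : ℕ, 1 ≤ C ∧ ∀ (n : ℕ) (G : SimpleGraph (Fin n)), 𝒢 n G → 0 < n →
        ∃ S : Set (Fin n), IsIsland G t S ∧ S.ncard ≤ C) ↔
      (∃ ε : ℝ, 0 < ε ∧ ∀ (n : ℕ) (G : SimpleGraph (Fin n)), 𝒢 n G →
        ∃ k : ℕ, ε * n ≤ (k : ℝ) ∧ HasDisjointIslands G t k)) ∧
    ((∃ ε : ℝ, 0 < ε ∧ ∀ (n : ℕ) (G : SimpleGraph (Fin n)), 𝒢 n G →
        ∃ k : ℕ, ε * n ≤ (k : ℝ) ∧ HasDisjointIslands G t k) ↔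
      (∃ ε : ℝ, 0 < ε ∧ ∀ (n : ℕ) (G : SimpleGraph (Fin n)), 𝒢 n G → 0 < n →
        ∀ A : Set (Fin n), (A.ncard : ℝ) ≤ ε * n → ¬ Percolates G t A)) := by
  have h13 : (∃ m : ℕ, 1 ≤ m ∧ ¬ MemClass 𝒢 (completeBipartiteGraph (Fin t) (Fin m)) ∧
      ¬ MemClass 𝒢 (IplusP (t-1) m)) →
      ∃ ε : ℝ, 0 < ε ∧ ∀ (n : ℕ) (G : SimpleGraph (Fin n)), 𝒢 n G →
        ∃ k : ℕ, ε * n ≤ (k : ℝ) ∧ HasDisjointIslands G t k := by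
    rintro ⟨m, -, hK, hI⟩
    obtain ⟨ε, hε, h⟩ := exists_pos_hasDisjointIslands w t m ht
    exact ⟨ε, hε, fun n G hG => h n G (htw n G hG) (fun h' => hK (hmc.memClass_of_isMinorOf hG h'))
      fun h' => hI (hmc.memClass_of_isMinorOf hG h')⟩
  have h32 : (∃ ε : ℝ, 0 < ε ∧ ∀ (n : ℕ) (G : SimpleGraph (Fin n)), 𝒢 n G →
      ∃ k : ℕ, ε * n ≤ (k : ℝ) ∧ HasDisjointIslands G t k) →
      ∃ C : ℕ, 1 ≤ C ∧ ∀ (n : ℕ) (G : SimpleGraph (Fin n)), 𝒢 n G → 0 < n →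
        ∃ S : Set (Fin n), IsIsland G t S ∧ S.ncard ≤ C := by
    rintro ⟨ε, hε, h⟩
    refine ⟨⌈1 / ε⌉₊ + 1, by omega, fun n G hG hn => ?_⟩
    obtain ⟨k, hk, hkisl⟩ := h n G hG
    have hn' : (0 : ℝ) < n := by exact_mod_cast hn
    have hk0 : 0 < k := by
      have : (0 : ℝ) < k := lt_of_lt_of_le (by positivity) hk
      exact_mod_cast this
    obtain ⟨S, hS, hSk⟩ := hkisl.exists_ncard_mul_le hk0
    refine ⟨S, hS, ?_⟩
    have h1 : (k : ℝ) * S.ncard ≤ n := by exact_mod_cast hSk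
    have h2 : ε * n * S.ncard ≤ n := le_trans (by gcongr) h1
    have h3 : (S.ncard : ℝ) ≤ 1 / ε := by
      rw [le_div_iff₀ hε]
      refine le_of_mul_le_mul_right ?_ hn'
      linarith
    have h4 : (S.ncard : ℝ) ≤ (⌈1 / ε⌉₊ : ℝ) := h3.trans (Nat.le_ceil _)
    have h5 : S.ncard ≤ ⌈1 / ε⌉₊ := by exact_mod_cast h4
    omega
  have h21 : (∃ C : ℕ, 1 ≤ C ∧ ∀ (n : ℕ) (G : SimpleGraph (Fin n)), 𝒢 n G → 0 < n →
      ∃ S : Set (Fin n), IsIsland G t S ∧ S.ncard ≤ C) →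
      ∃ m : ℕ, 1 ≤ m ∧ ¬ MemClass 𝒢 (completeBipartiteGraph (Fin t) (Fin m)) ∧
        ¬ MemClass 𝒢 (IplusP (t-1) m) := by
    rintro ⟨C, -, h⟩
    have hne : Nonempty (Fin (C + t + 1)) := ⟨0⟩
    refine ⟨C + t + 1, by omega, fun hK => ?_, fun hI => ?_⟩
    · obtain ⟨S, hS, hSC⟩ := exists_isIsland_of_memClass h hK
      have := hS.lt_ncard_add_of_completeBipartiteGraph
      omega
    · obtain ⟨S, hS, hSC⟩ := exists_isIsland_of_memClass h hI
      have := hS.lt_ncard_add_of_IplusP ht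
      omega
  have h34 : (∃ ε : ℝ, 0 < ε ∧ ∀ (n : ℕ) (G : SimpleGraph (Fin n)), 𝒢 n G →
      ∃ k : ℕ, ε * n ≤ (k : ℝ) ∧ HasDisjointIslands G t k) →
      ∃ ε : ℝ, 0 < ε ∧ ∀ (n : ℕ) (G : SimpleGraph (Fin n)), 𝒢 n G → 0 < n →
        ∀ A : Set (Fin n), (A.ncard : ℝ) ≤ ε * n → ¬ Percolates G t A := by
    rintro ⟨ε, hε, h⟩
    refine ⟨ε / 2, by positivity, fun n G hG hn A hA hperc => ?_⟩
    obtain ⟨k, hk, hkisl⟩ := h n G hG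
    have h1 : (k : ℝ) ≤ A.ncard := by exact_mod_cast hkisl.le_ncard_of_percolates hperc
    have hn' : (0 : ℝ) < n := by exact_mod_cast hn
    have h2 : 0 < ε * n := by positivity
    linarith
  have h41 : (∃ ε : ℝ, 0 < ε ∧ ∀ (n : ℕ) (G : SimpleGraph (Fin n)), 𝒢 n G → 0 < n →
      ∀ A : Set (Fin n), (A.ncard : ℝ) ≤ ε * n → ¬ Percolates G t A) →
      ∃ m : ℕ, 1 ≤ m ∧ ¬ MemClass 𝒢 (completeBipartiteGraph (Fin t) (Fin m)) ∧
        ¬ MemClass 𝒢 (IplusP (t-1) m) := by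
    rintro ⟨ε, hε, h⟩
    set m := ⌈t / ε⌉₊ + 1 with hm
    have hm0 : 0 < m := by omega
    have hne : Nonempty (Fin m) := ⟨⟨0, hm0⟩⟩
    have hle : ∀ a b : ℕ, a ≤ t → m ≤ b → (a : ℝ) ≤ ε * b := by
      intro a b ha hb
      have h1 : (t : ℝ) / ε ≤ b := (Nat.le_ceil _).trans (by exact_mod_cast (by omega))
      rw [div_le_iff₀ hε] at h1
      have h2 : (a : ℝ) ≤ t := by exact_mod_cast ha
      linarith
    refine ⟨m, hm0, not_memClass_of_percolates h (percolates_completeBipartiteGraph t m)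
      (hle _ _ ?_ ?_), not_memClass_of_percolates h (percolates_IplusP ht hm0) (hle _ _ ?_ ?_)⟩
    · rw [← Set.image_univ, Set.ncard_image_of_injective _ Sum.inl_injective]
      simp
    · simp
    · refine (Set.ncard_insert_le _ _).trans ?_
      rw [← Set.image_univ, Set.ncard_image_of_injective _ Sum.inl_injective]
      simp only [Set.ncard_univ, Nat.card_fin]
      omega
    · simp
  exact ⟨⟨fun h => h32 (h13 h), h21⟩, ⟨fun h => h13 (h21 h), h32⟩, ⟨h34, fun h => h13 (h41 h)⟩⟩
end

section
/- Let f : ℕ → ℕ be a non-decreasing significantly sublinear function and let 𝒢 be a class of finite graphs closed under taking subgraphs that has f-separators. Then for every ε > 0 there exists C such that for every n-vertex graph G ∈ 𝒢 there exists a set X ⊆ V(G) with |X| ≤ ε·n such that every connected component of G − X has at most C vertices. -/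
open SimpleGraph

/-- If no edge joins `A` to `B`, a connected set inside `A ∪ B` that meets `A` lies in `A`. -/
theorem subset_of_connected_induce {V : Type*} {G : SimpleGraph V} {S A B : Set V}
    (hS : (G.induce S).Connected) (hAB : S ⊆ A ∪ B)
    (hadj : ∀ a ∈ A, ∀ b ∈ B, ¬ G.Adj a b) {u : V} (huS : u ∈ S) (huA : u ∈ A) : S ⊆ A := by
  have key : ∀ x y : S, (G.induce S).Walk x y → (x : V) ∈ A → (y : V) ∈ A := by
    intro x y p
    induction p with
    | nil => exact id
    | cons h _ ih =>
      intro hx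
      exact ih ((hAB (Subtype.coe_prop _)).resolve_right fun hB => hadj _ hx _ hB h)
  intro v hv
  obtain ⟨p⟩ := hS.preconnected ⟨u, huS⟩ ⟨v, hv⟩
  exact key _ _ p huA

/-- Every vertex set of a graph in a subgraph-closed class with `f`-separators splits into
a small set and two parts of balanced sizes with no edges between them. -/
theorem exists_balanced_split {f : ℕ → ℕ} {𝒢 : ∀ n : ℕ, SimpleGraph (Fin n) → Prop}
    (hclosed : SubgraphClosed 𝒢) (hsep : HasSeparators f 𝒢) {n : ℕ} {G : SimpleGraph (Fin n)}
    (hG : 𝒢 n G) (A : Finset (Fin n)) :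
    ∃ X A₁ A₂ : Finset (Fin n), A = X ∪ (A₁ ∪ A₂) ∧ Disjoint A₁ A₂ ∧
      (∀ a ∈ A₁, ∀ b ∈ A₂, ¬ G.Adj a b) ∧ X.card ≤ f A.card ∧
      3 * A₁.card ≤ 2 * A.card ∧ 3 * A₂.card ≤ 2 * A.card := by
  classical
  let e : Fin A.card ↪ Fin n := (A.orderEmbOfFin rfl).toEmbedding
  have hrange : ∀ v, v ∈ A ↔ ∃ i, e i = v := fun v => by
    rw [← Finset.mem_coe, ← A.range_orderEmbOfFin rfl]
    rfl
  obtain ⟨L, R, hLR, hX, hL, hR⟩ := hsep _ (G.comap e)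
    (hclosed G (G.comap e) hG ⟨e, e.injective, fun _ _ h => h⟩)
  rw [Set.ncard_eq_toFinset_card'] at hX hL hR
  refine ⟨(L.verts ∩ R.verts).toFinset.map e, (L.verts \ R.verts).toFinset.map e,
    (R.verts \ L.verts).toFinset.map e, ?_, ?_, ?_, ?_, ?_, ?_⟩
  · have hv : ∀ i, i ∈ L.verts ∨ i ∈ R.verts := fun i => by
      have : i ∈ (L ⊔ R).verts := by rw [hLR]; trivial
      simpa using this
    ext v
    rw [hrange]
    simp only [Finset.mem_union, Finset.mem_map, Set.mem_toFinset, Set.mem_inter_iff,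
      Set.mem_sdiff]
    constructor
    · rintro ⟨i, rfl⟩
      have := hv i
      by_cases h₁ : i ∈ L.verts <;> by_cases h₂ : i ∈ R.verts
      · exact .inl ⟨i, ⟨h₁, h₂⟩, rfl⟩
      · exact .inr (.inl ⟨i, ⟨h₁, h₂⟩, rfl⟩)
      · exact .inr (.inr ⟨i, ⟨h₂, h₁⟩, rfl⟩)
      · tauto
    · rintro (⟨i, -, h⟩ | ⟨i, -, h⟩ | ⟨i, -, h⟩) <;> exact ⟨i, h⟩
  · rw [Finset.disjoint_map, Set.disjoint_toFinset]
    exact disjoint_sdiff_sdiff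
  · simp only [Finset.mem_map, Set.mem_toFinset]
    rintro _ ⟨i, hi, rfl⟩ _ ⟨j, hj, rfl⟩ hadj
    have h : (L ⊔ R).Adj i j := by rw [hLR]; exact hadj
    rcases h with h | h
    · exact hj.2 h.snd_mem
    · exact hi.2 h.fst_mem
  all_goals simpa only [Finset.card_map]

/-- Splitting a vertex set of size at most `(3/2)^(i₀+k)` recursively down to parts of size at
most `(3/2)^i₀`. -/
theorem exists_fragmenting_set {f : ℕ → ℕ} (hmono : Monotone f)
    {𝒢 : ∀ n : ℕ, SimpleGraph (Fin n) → Prop}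
    (hclosed : SubgraphClosed 𝒢) (hsep : HasSeparators f 𝒢) {n : ℕ} {G : SimpleGraph (Fin n)}
    (hG : 𝒢 n G) (i₀ k : ℕ) (A : Finset (Fin n)) (hA : (A.card : ℝ) ≤ (3 / 2 : ℝ) ^ (k + i₀)) :
    ∃ X : Finset (Fin n),
      (X.card : ℝ) ≤ A.card * ∑ j ∈ Finset.range k,
        (3 / 2 : ℝ) * (f ⌈(3 / 2 : ℝ) ^ (j + (i₀ + 1))⌉₊ / (3 / 2 : ℝ) ^ (j + (i₀ + 1))) ∧
      ∀ S : Set (Fin n), S ⊆ A → Disjoint S X → (G.induce S).Connected →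
        S.ncard ≤ ⌈(3 / 2 : ℝ) ^ i₀⌉₊ := by
  classical
  induction k generalizing A with
  | zero =>
    refine ⟨∅, by simp, fun S hS _ _ => ?_⟩
    have h₁ : S.ncard ≤ A.card := by
      simpa using Set.ncard_le_ncard hS A.finite_toSet
    rw [zero_add] at hA
    exact_mod_cast (Nat.cast_le.mpr h₁).trans (hA.trans (Nat.le_ceil _))
  | succ k ih =>
    rw [Finset.sum_range_succ]
    set s := ∑ j ∈ Finset.range k,
      (3 / 2 : ℝ) * (f ⌈(3 / 2 : ℝ) ^ (j + (i₀ + 1))⌉₊ / (3 / 2 : ℝ) ^ (j + (i₀ + 1))) with hs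
    have hpow : (3 / 2 : ℝ) ^ (k + (i₀ + 1)) = 3 / 2 * (3 / 2 : ℝ) ^ (k + i₀) := by ring
    have hpow' : (3 / 2 : ℝ) ^ (k + 1 + i₀) = 3 / 2 * (3 / 2 : ℝ) ^ (k + i₀) := by ring
    have hpos : (0 : ℝ) < (3 / 2 : ℝ) ^ (k + i₀) := by positivity
    by_cases hsmall : (A.card : ℝ) ≤ (3 / 2 : ℝ) ^ (k + i₀)
    · obtain ⟨X, hX, hXS⟩ := ih A hsmall
      refine ⟨X, hX.trans ?_, hXS⟩
      gcongr
      exact le_add_of_nonneg_right (by positivity)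
    · obtain ⟨X₀, A₁, A₂, hAeq, hdisj, hadj, hX₀, h₁, h₂⟩ :=
        exists_balanced_split hclosed hsep hG A
      rw [hpow'] at hA
      have h₁' : (3 : ℝ) * A₁.card ≤ 2 * A.card := by exact_mod_cast h₁
      have h₂' : (3 : ℝ) * A₂.card ≤ 2 * A.card := by exact_mod_cast h₂
      obtain ⟨X₁, hX₁, hS₁⟩ := ih A₁ (by linarith)
      obtain ⟨X₂, hX₂, hS₂⟩ := ih A₂ (by linarith)
      refine ⟨X₀ ∪ (X₁ ∪ X₂), ?_, ?_⟩
      · have hcard : ((X₀ ∪ (X₁ ∪ X₂)).card : ℝ) ≤ X₀.card + (X₁.card + X₂.card) := by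
          exact_mod_cast (Finset.card_union_le _ _).trans
            (Nat.add_le_add_left (Finset.card_union_le _ _) _)
        have hparts : (A₁.card : ℝ) + A₂.card ≤ A.card := by
          rw [← Nat.cast_add, ← Finset.card_union_of_disjoint hdisj]
          exact_mod_cast Finset.card_le_card (hAeq ▸ Finset.subset_union_right)
        have hs0 : 0 ≤ s := Finset.sum_nonneg fun _ _ => by positivity
        have hf : (X₀.card : ℝ) ≤ f ⌈(3 / 2 : ℝ) ^ (k + (i₀ + 1))⌉₊ := by
          refine Nat.cast_le.mpr (hX₀.trans (hmono ?_))
          rw [hpow]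
          exact_mod_cast hA.trans (Nat.le_ceil _)
        have hlast : (f ⌈(3 / 2 : ℝ) ^ (k + (i₀ + 1))⌉₊ : ℝ) ≤ A.card * ((3 / 2 : ℝ) *
            (f ⌈(3 / 2 : ℝ) ^ (k + (i₀ + 1))⌉₊ / (3 / 2 : ℝ) ^ (k + (i₀ + 1)))) := by
          generalize f ⌈(3 / 2 : ℝ) ^ (k + (i₀ + 1))⌉₊ = c
          have : (A.card : ℝ) * (3 / 2 * (c / (3 / 2 * (3 / 2 : ℝ) ^ (k + i₀)))) =
              c * (A.card / (3 / 2 : ℝ) ^ (k + i₀)) := by field_simp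
          rw [hpow, this]
          exact le_mul_of_one_le_right (Nat.cast_nonneg c)
            ((one_le_div hpos).mpr (not_le.mp hsmall).le)
        nlinarith [mul_le_mul_of_nonneg_right hparts hs0]
      · intro S hSA hSX hconn
        rw [Finset.coe_union, Finset.coe_union, Set.disjoint_union_right,
          Set.disjoint_union_right] at hSX
        obtain ⟨hd₀, hd₁, hd₂⟩ := hSX
        have hS : S ⊆ (A₁ : Set (Fin n)) ∪ A₂ := fun v hv => by
          have hvA := hSA hv
          rw [hAeq, Finset.coe_union, Finset.coe_union] at hvA
          exact hvA.resolve_left (Set.disjoint_left.mp hd₀ hv)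
        obtain ⟨u, hu⟩ := hconn.nonempty
        rcases hS hu with hu' | hu'
        · exact hS₁ S (subset_of_connected_induce hconn hS hadj hu hu') hd₁ hconn
        · refine hS₂ S (subset_of_connected_induce hconn (Set.union_comm _ _ ▸ hS)
            (fun a ha b hb h => hadj b hb a ha h.symm) hu hu') hd₂ hconn

/-- if `f` is non-decreasing and significantly sublinear and the
subgraph-closed class `𝒢` has `f`-separators, then for every `ε > 0` there is `C` such
that every `n`-vertex graph in `𝒢` has a set `X` of at most `εn` vertices whose removal
leaves components of at most `C` vertices. -/
theorem stmt15 (f : ℕ → ℕ) (hmono : Monotone f) (hss : SignificantlySublinear f)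
    (𝒢 : ∀ n : ℕ, SimpleGraph (Fin n) → Prop) (hclosed : SubgraphClosed 𝒢)
    (hsep : HasSeparators f 𝒢) :
    ∀ ε : ℝ, 0 < ε → ∃ C : ℕ, ∀ (n : ℕ) (G : SimpleGraph (Fin n)), 𝒢 n G →
      ∃ X : Set (Fin n), (X.ncard : ℝ) ≤ ε * n ∧
        ∀ S : Set (Fin n), Disjoint S X → (G.induce S).Connected → S.ncard ≤ C := by
  intro ε hε
  let a : ℕ → ℝ := fun i => (f ⌈(3 / 2 : ℝ) ^ i⌉₊ : ℝ) / (3 / 2 : ℝ) ^ i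
  have hsum : Summable a := hss
  obtain ⟨i₀, hi₀⟩ := (((tendsto_sum_nat_add a).comp (Filter.tendsto_add_atTop_nat 1)).eventually
    (gt_mem_nhds (show (0 : ℝ) < 2 / 3 * ε by positivity))).exists
  refine ⟨⌈(3 / 2 : ℝ) ^ i₀⌉₊, fun n G hG => ?_⟩
  obtain ⟨k, hk⟩ := pow_unbounded_of_one_lt (n : ℝ) (show (1 : ℝ) < 3 / 2 by norm_num)
  obtain ⟨X, hX, hXS⟩ := exists_fragmenting_set hmono hclosed hsep hG i₀ k Finset.univ (by
    rw [Finset.card_univ, Fintype.card_fin]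
    exact hk.le.trans (pow_le_pow_right₀ (by norm_num) (Nat.le_add_right k i₀)))
  refine ⟨X, ?_, fun S hS => hXS S (by simp) hS⟩
  rw [Set.ncard_coe_finset]
  rw [Finset.card_univ, Fintype.card_fin, ← Finset.mul_sum] at hX
  have htail : ∑ j ∈ Finset.range k, a (j + (i₀ + 1)) ≤ ∑' j, a (j + (i₀ + 1)) :=
    ((summable_nat_add_iff (i₀ + 1)).mpr hsum).sum_le_tsum _ fun _ _ => by positivity
  have hle : 3 / 2 * ∑ j ∈ Finset.range k, a (j + (i₀ + 1)) ≤ ε := by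
    have : ∑' j, a (j + (i₀ + 1)) < 2 / 3 * ε := hi₀
    linarith
  calc (X.card : ℝ) ≤ n * (3 / 2 * ∑ j ∈ Finset.range k, a (j + (i₀ + 1))) := hX
    _ ≤ n * ε := by gcongr
    _ = ε * n := mul_comm _ _
end

section
/- Let G be a finite graph, let t ≥ 1 be an integer, and let A ⊆ V(G) be a t-enclave in G, i.e. e_G(A) < t·|A|. Then there exists a t-island S ⊆ A in G. -/
open SimpleGraph

/-- Removing a vertex `v` from `A` loses all edges from `v` to the outside of `A`. -/
lemma edgesTouching_sdiff_singleton_add_le {V : Type*} [Finite V] (G : SimpleGraph V)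
    {A : Set V} {v : V} (hv : v ∈ A) :
    edgesTouching G (A \ {v}) + (G.neighborSet v \ A).ncard ≤ edgesTouching G A := by
  unfold edgesTouching
  have hinj : Function.Injective fun w : V => s(v, w) := fun _ _ h => Sym2.congr_right.mp h
  rw [← Set.ncard_image_of_injective (G.neighborSet v \ A) hinj, ← Set.ncard_union_eq]
  · refine Set.ncard_le_ncard ?_ (Set.toFinite _)
    rintro e (⟨he, u, hu, hue⟩ | ⟨w, hw, rfl⟩)
    · exact ⟨he, u, hu.1, hue⟩
    · exact ⟨hw.1, v, hv, Sym2.mem_mk_left v w⟩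
  · rw [Set.disjoint_left]
    rintro _ ⟨-, u, hu, hue⟩ ⟨w, hw, rfl⟩
    rcases Sym2.mem_iff.mp hue with rfl | rfl
    · exact hu.2 rfl
    · exact hw.2 hu.1

/-- if `A` is a `t`-enclave in `G` (the number of edges with at least one
end in `A` is less than `t|A|`), then `G` has a `t`-island `S ⊆ A`. -/
theorem stmt16 {V : Type} [Fintype V] (G : SimpleGraph V) (t : ℕ) (ht : 1 ≤ t)
    (A : Set V) (hA : edgesTouching G A < t * A.ncard) :
    ∃ S : Set V, S ⊆ A ∧ IsIsland G t S := by
  induction hn : A.ncard generalizing A with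
  | zero => simp [hn] at hA
  | succ n ih =>
    have hne : A.Nonempty := (Set.ncard_pos).mp (by omega)
    by_cases h : IsIsland G t A
    · exact ⟨A, subset_rfl, h⟩
    obtain ⟨v, hv, hvt⟩ : ∃ v ∈ A, t ≤ (G.neighborSet v \ A).ncard := by
      by_contra! hc
      exact h ⟨hne, hc⟩
    have hcard : (A \ {v}).ncard = n := by
      rw [Set.ncard_sdiff_singleton_of_mem hv, hn, Nat.add_sub_cancel]
    have hle := edgesTouching_sdiff_singleton_add_le G hv
    obtain ⟨S, hS, hisl⟩ := ih (A \ {v}) (by rw [hcard]; rw [hn, mul_add] at hA; omega) hcard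
    exact ⟨S, hS.trans Set.sdiff_subset, hisl⟩
end

section
/- Let f : ℕ → ℕ be a non-decreasing significantly sublinear function and let 𝒢 be a class of finite graphs closed under taking subgraphs that has f-separators. Then for every integer t ≥ 1 and every real α > 0 there exists δ > 0 such that every graph G ∈ 𝒢 with |E(G)| ≤ (t − α)·|V(G)| contains at least δ·|V(G)| pairwise disjoint t-islands. -/
open SimpleGraph

lemma edgesTouching_add_le {V : Type*} [Finite V] (G : SimpleGraph V) {A P Q : Set V}
    (hP : P ⊆ A) (hQ : Q ⊆ A) (hPQ : Disjoint P Q) (hadj : ∀ u ∈ P, ∀ v ∈ Q, ¬ G.Adj u v) :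
    edgesTouching G P + edgesTouching G Q ≤ edgesTouching G A := by
  unfold edgesTouching
  rw [← Set.ncard_union_eq _ (Set.toFinite _) (Set.toFinite _)]
  · apply Set.ncard_le_ncard _ (Set.toFinite _)
    rintro e (⟨he, v, hv, hve⟩ | ⟨he, v, hv, hve⟩)
    · exact ⟨he, v, hP hv, hve⟩
    · exact ⟨he, v, hQ hv, hve⟩
  · rw [Set.disjoint_left]
    rintro e ⟨he, v, hv, hve⟩ ⟨-, u, hu, hue⟩
    have hne : v ≠ u := fun h => Set.disjoint_left.1 hPQ hv (h ▸ hu)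
    rw [(Sym2.mem_and_mem_iff hne).1 ⟨hve, hue⟩] at he
    exact hadj v hv u hu he

/-- A set of vertices containing no `t`-island is touched by at least `t` edges per vertex. -/
lemma mul_card_le_edgesTouching {V : Type*} [Finite V] (G : SimpleGraph V) (t : ℕ)
    (A : Finset V) (hA : ∀ S : Set V, S ⊆ A → ¬ IsIsland G t S) :
    t * A.card ≤ edgesTouching G A := by
  classical
  induction A using Finset.strongInduction with
  | H A ih =>
    rcases A.eq_empty_or_nonempty with rfl | hne
    · simp
    have hisl := hA A subset_rfl
    unfold IsIsland at hisl
    push Not at hisl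
    obtain ⟨v, hvA, hv⟩ := hisl (by simpa using hne)
    have hvA' : v ∈ A := by simpa using hvA
    have h := ih (A.erase v) (Finset.erase_ssubset hvA') fun S hS =>
      hA S (hS.trans (by simp))
    have hcard := Finset.card_erase_add_one hvA'
    have hstar : ((fun u => s(v, u)) '' (G.neighborSet v \ A)).ncard
        = (G.neighborSet v \ A).ncard :=
      Set.ncard_image_of_injective _ fun a b hab => Sym2.congr_right.1 hab
    have hsum : edgesTouching G (A.erase v : Finset V) + (G.neighborSet v \ A).ncard
        ≤ edgesTouching G A := by
      rw [← hstar]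
      unfold edgesTouching
      rw [← Set.ncard_union_eq _ (Set.toFinite _) (Set.toFinite _)]
      · apply Set.ncard_le_ncard _ (Set.toFinite _)
        rintro e (⟨he, u, hu, hue⟩ | ⟨u, hu, rfl⟩)
        · exact ⟨he, u, Finset.mem_of_mem_erase hu, hue⟩
        · exact ⟨hu.1, v, hvA, by simp⟩
      · rw [Set.disjoint_left]
        rintro e ⟨-, w, hw, hwe⟩ ⟨u, hu, rfl⟩
        have hw' : w ≠ v ∧ w ∈ A := Finset.mem_erase.1 (Finset.mem_coe.1 hw)
        rcases Sym2.mem_iff.1 hwe with rfl | rfl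
        · exact hw'.1 rfl
        · exact hu.2 hw'.2
    calc t * A.card = t * (A.erase v).card + t := by rw [← hcard]; ring
      _ ≤ _ := (Nat.add_le_add h hv).trans hsum

/-- In a subgraph-closed class with `f`-separators, every vertex subset can be separated. -/
lemma exists_separation {f : ℕ → ℕ} {𝒢 : ∀ n : ℕ, SimpleGraph (Fin n) → Prop}
    (hclosed : SubgraphClosed 𝒢) (hsep : HasSeparators f 𝒢) {n : ℕ} {G : SimpleGraph (Fin n)}
    (hG : 𝒢 n G) (A : Finset (Fin n)) :
    ∃ P Q : Finset (Fin n), P ⊆ A ∧ Q ⊆ A ∧ Disjoint P Q ∧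
      (∀ u ∈ P, ∀ v ∈ Q, ¬ G.Adj u v) ∧ A.card ≤ P.card + Q.card + f A.card ∧
      3 * P.card ≤ 2 * A.card ∧ 3 * Q.card ≤ 2 * A.card := by
  classical
  let φ := A.orderEmbOfFin rfl
  obtain ⟨L, R, hLR, hS, hL, hR⟩ := hsep A.card (G.comap φ)
    (hclosed G _ hG ⟨φ, φ.injective, fun _ _ h => h⟩)
  have hcov : ∀ v, v ∈ L.verts ∨ v ∈ R.verts := fun v => by
    have : v ∈ (L ⊔ R).verts := by rw [hLR]; trivial
    simpa using this
  refine ⟨((L.verts \ R.verts).toFinset).map φ.toEmbedding,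
    ((R.verts \ L.verts).toFinset).map φ.toEmbedding, ?_, ?_, ?_, ?_, ?_, ?_, ?_⟩
  · intro x hx
    obtain ⟨y, -, rfl⟩ := Finset.mem_map.1 hx
    exact A.orderEmbOfFin_mem rfl y
  · intro x hx
    obtain ⟨y, -, rfl⟩ := Finset.mem_map.1 hx
    exact A.orderEmbOfFin_mem rfl y
  · rw [Finset.disjoint_map, Set.disjoint_toFinset]
    exact disjoint_sdiff_sdiff
  · intro u hu v hv hadj
    obtain ⟨a, ha, rfl⟩ := Finset.mem_map.1 hu
    obtain ⟨b, hb, rfl⟩ := Finset.mem_map.1 hv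
    rw [Set.mem_toFinset] at ha hb
    have : (L ⊔ R).Adj a b := by rw [hLR]; exact hadj
    rcases this with h | h
    · exact hb.2 (L.edge_vert h.symm)
    · exact ha.2 (R.edge_vert h)
  · rw [Finset.card_map, Finset.card_map, ← Set.ncard_eq_toFinset_card',
      ← Set.ncard_eq_toFinset_card']
    have huniv : (Set.univ : Set (Fin A.card)) ⊆
        (L.verts \ R.verts ∪ R.verts \ L.verts) ∪ L.verts ∩ R.verts := by
      intro v _
      have := hcov v
      simp only [Set.mem_union, Set.mem_sdiff, Set.mem_inter_iff]
      tauto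
    have h := Set.ncard_le_ncard huniv (Set.toFinite _)
    have h₁ := Set.ncard_union_le (L.verts \ R.verts ∪ R.verts \ L.verts) (L.verts ∩ R.verts)
    have h₂ := Set.ncard_union_le (L.verts \ R.verts) (R.verts \ L.verts)
    rw [Set.ncard_univ, Nat.card_fin] at h
    omega
  · rwa [Finset.card_map, ← Set.ncard_eq_toFinset_card']
  · rwa [Finset.card_map, ← Set.ncard_eq_toFinset_card']

/-- Recursive separation of `A` down to pieces of size at most `(3/2)^i₀`, collecting one island
from each piece that contains one and counting edges at the other pieces. -/
lemma exists_disjoint_islands {f : ℕ → ℕ} (hmono : Monotone f)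
    {𝒢 : ∀ n : ℕ, SimpleGraph (Fin n) → Prop}
    (hclosed : SubgraphClosed 𝒢) (hsep : HasSeparators f 𝒢) (t i₀ : ℕ) {n : ℕ}
    {G : SimpleGraph (Fin n)} (hG : 𝒢 n G) (m : ℕ) (A : Finset (Fin n))
    (hA : (A.card : ℝ) ≤ (3 / 2 : ℝ) ^ (m + i₀)) :
    ∃ (ι : Type) (_ : Fintype ι) (F : ι → Set (Fin n)),
      (∀ i, IsIsland G t (F i)) ∧ (∀ i, F i ⊆ A) ∧ Pairwise (Function.onFun Disjoint F) ∧
      (t : ℝ) * A.card ≤ edgesTouching G A + t * (3 / 2 : ℝ) ^ i₀ * Fintype.card ι +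
        t * (3 / 2 * ∑ j ∈ Finset.range m,
          (f ⌈(3 / 2 : ℝ) ^ (j + (i₀ + 1))⌉₊ : ℝ) / (3 / 2 : ℝ) ^ (j + (i₀ + 1))) * A.card := by
  induction m generalizing A with
  | zero =>
    by_cases h : ∃ S : Set (Fin n), S ⊆ A ∧ IsIsland G t S
    · obtain ⟨S, hSA, hS⟩ := h
      refine ⟨Unit, inferInstance, fun _ => S, fun _ => hS, fun _ => hSA,
        fun i j hij => (hij rfl).elim, ?_⟩
      rw [zero_add] at hA
      have := mul_le_mul_of_nonneg_left hA (Nat.cast_nonneg (α := ℝ) t)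
      have h0 : (0 : ℝ) ≤ edgesTouching G A := Nat.cast_nonneg _
      simp only [Fintype.card_unit, Nat.cast_one, Finset.range_zero, Finset.sum_empty]
      linarith
    · push Not at h
      refine ⟨Empty, inferInstance, Empty.elim, fun i => i.elim, fun i => i.elim,
        fun i => i.elim, ?_⟩
      have : (t : ℝ) * A.card ≤ edgesTouching G A := by
        exact_mod_cast mul_card_le_edgesTouching G t A h
      simpa using this
  | succ m ih =>
    rw [Finset.sum_range_succ]
    set c := ∑ j ∈ Finset.range m,
      (f ⌈(3 / 2 : ℝ) ^ (j + (i₀ + 1))⌉₊ : ℝ) / (3 / 2 : ℝ) ^ (j + (i₀ + 1)) with hc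
    have hc0 : 0 ≤ c := Finset.sum_nonneg fun _ _ => by positivity
    have hindex : m + (i₀ + 1) = (m + i₀) + 1 := by ring
    rw [hindex]
    rw [show m + 1 + i₀ = (m + i₀) + 1 by ring] at hA
    set r := (3 / 2 : ℝ) ^ (m + i₀) with hr
    have hr0 : 0 < r := by positivity
    have hpow : (3 / 2 : ℝ) ^ (m + i₀ + 1) = 3 / 2 * r := by rw [pow_succ]; ring
    rw [hpow] at hA ⊢
    set φ : ℝ := (f ⌈3 / 2 * r⌉₊ : ℝ) with hφ
    have hφ0 : 0 ≤ φ := Nat.cast_nonneg _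
    have ht0 : (0 : ℝ) ≤ t := Nat.cast_nonneg _
    by_cases hsmall : (A.card : ℝ) ≤ r
    · obtain ⟨ι, hι, F, h₁, h₂, h₃, h₄⟩ := ih A hsmall
      refine ⟨ι, hι, F, h₁, h₂, h₃, h₄.trans ?_⟩
      gcongr
      exact le_add_of_nonneg_right (by positivity)
    · push Not at hsmall
      obtain ⟨P, Q, hPA, hQA, hPQ, hadj, hcard, hP, hQ⟩ := exists_separation hclosed hsep hG A
      have hP' : 3 * (P.card : ℝ) ≤ 2 * A.card := by exact_mod_cast hP
      have hQ' : 3 * (Q.card : ℝ) ≤ 2 * A.card := by exact_mod_cast hQ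
      obtain ⟨ι, hι, F, h₁, h₂, h₃, h₄⟩ := ih P (by linarith)
      obtain ⟨κ, hκ, K, k₁, k₂, k₃, k₄⟩ := ih Q (by linarith)
      have hPQs : Disjoint (P : Set (Fin n)) Q := Finset.disjoint_coe.2 hPQ
      refine ⟨ι ⊕ κ, inferInstance, Sum.elim F K, ?_, ?_, ?_, ?_⟩
      · rintro (i | i)
        exacts [h₁ i, k₁ i]
      · rintro (i | i)
        exacts [(h₂ i).trans (by exact_mod_cast hPA), (k₂ i).trans (by exact_mod_cast hQA)]
      · rintro (i | i) (j | j) hij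
        · exact h₃ fun h => hij (by rw [h])
        · exact hPQs.mono (h₂ i) (k₂ j)
        · exact hPQs.symm.mono (k₂ i) (h₂ j)
        · exact k₃ fun h => hij (by rw [h])
      · have hedge : (edgesTouching G P : ℝ) + edgesTouching G Q ≤ edgesTouching G A := by
          exact_mod_cast edgesTouching_add_le G (Finset.coe_subset.2 hPA)
            (Finset.coe_subset.2 hQA) hPQs hadj
        have hfA : (f A.card : ℝ) ≤ φ := by
          exact Nat.cast_le.2 <| hmono (Nat.cast_le.1 (hA.trans (Nat.le_ceil _)))
        have hcard' : (A.card : ℝ) ≤ P.card + Q.card + φ := by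
          have : (A.card : ℝ) ≤ P.card + Q.card + f A.card := by exact_mod_cast hcard
          linarith
        have hsub : (P.card : ℝ) + Q.card ≤ A.card := by
          rw [← Nat.cast_add, ← Finset.card_union_of_disjoint hPQ]
          exact_mod_cast Finset.card_le_card (Finset.union_subset hPA hQA)
        have hφA : φ ≤ 3 / 2 * (φ / (3 / 2 * r)) * A.card := by
          have : 3 / 2 * (φ / (3 / 2 * r)) = φ / r := by field_simp
          rw [this, div_mul_eq_mul_div, le_div_iff₀ hr0]
          gcongr
        clear_value c φ r
        have e₁ := mul_le_mul_of_nonneg_left hcard' ht0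
        have e₂ := mul_le_mul_of_nonneg_left hφA ht0
        have e₃ := mul_le_mul_of_nonneg_left hsub (show 0 ≤ t * (3 / 2 * c) by positivity)
        rw [Fintype.card_sum, Nat.cast_add]
        linarith

/-- if `f` is non-decreasing and significantly sublinear and the
subgraph-closed class `𝒢` has `f`-separators, then for every `t ≥ 1` and `α > 0` there is
`δ > 0` such that every `G ∈ 𝒢` with `|E(G)| ≤ (t-α)|V(G)|` contains at least `δ|V(G)|`
pairwise disjoint `t`-islands. -/
theorem stmt17 (f : ℕ → ℕ) (hmono : Monotone f) (hss : SignificantlySublinear f)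
    (𝒢 : ∀ n : ℕ, SimpleGraph (Fin n) → Prop) (hclosed : SubgraphClosed 𝒢)
    (hsep : HasSeparators f 𝒢) (t : ℕ) (ht : 1 ≤ t) (α : ℝ) (hα : 0 < α) :
    ∃ δ : ℝ, 0 < δ ∧ ∀ (n : ℕ) (G : SimpleGraph (Fin n)), 𝒢 n G →
      (G.edgeSet.ncard : ℝ) ≤ ((t : ℝ) - α) * n →
      ∃ k : ℕ, δ * n ≤ (k : ℝ) ∧ HasDisjointIslands G t k := by
  have ht0 : (0 : ℝ) < t := by exact_mod_cast ht
  unfold SignificantlySublinear at hss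
  set g : ℕ → ℝ := fun i => (f ⌈((3 : ℝ) / 2) ^ i⌉₊ : ℝ) / ((3 : ℝ) / 2) ^ i with hg
  have hg0 : ∀ i, 0 ≤ g i := fun i => by positivity
  obtain ⟨i₀, hi₀⟩ := (((tendsto_sum_nat_add g).comp (Filter.tendsto_add_atTop_nat 1)).eventually
    (gt_mem_nhds (show 0 < α / (3 * t) by positivity))).exists
  refine ⟨α / (2 * (t * (3 / 2 : ℝ) ^ i₀)), by positivity, fun n G hG hE => ?_⟩
  obtain ⟨m, hm⟩ := pow_unbounded_of_one_lt (n : ℝ) (show (1 : ℝ) < 3 / 2 by norm_num)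
  obtain ⟨ι, hι, F, h₁, -, h₃, h₄⟩ :=
    exists_disjoint_islands hmono hclosed hsep t i₀ hG m Finset.univ (by
      rw [Finset.card_univ, Fintype.card_fin]
      exact hm.le.trans (pow_le_pow_right₀ (by norm_num) (by omega)))
  refine ⟨Fintype.card ι, ?_, F ∘ (Fintype.equivFin ι).symm, fun i => h₁ _,
    fun i j hij => h₃ ((Fintype.equivFin ι).symm.injective.ne hij)⟩
  have hsum : ∑ j ∈ Finset.range m, g (j + (i₀ + 1)) ≤ α / (3 * t) :=
    (((summable_nat_add_iff (i₀ + 1)).2 hss).sum_le_tsum _ fun _ _ => hg0 _).trans hi₀.le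
  have htouch : (edgesTouching G (Finset.univ : Finset (Fin n)) : ℝ) ≤ G.edgeSet.ncard := by
    exact_mod_cast Set.ncard_le_ncard (Set.sep_subset _ _) (Set.toFinite _)
  rw [Finset.card_univ, Fintype.card_fin] at h₄
  have hloss : t * (3 / 2 * ∑ j ∈ Finset.range m, g (j + (i₀ + 1))) * n ≤ α / 2 * n := by
    gcongr
    calc t * (3 / 2 * ∑ j ∈ Finset.range m, g (j + (i₀ + 1)))
        ≤ t * (3 / 2 * (α / (3 * t))) := by gcongr
      _ = α / 2 := by field_simp
  rw [div_mul_eq_mul_div, div_le_iff₀ (by positivity)]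
  simp only [hg] at hloss
  linarith
end

section
/- Let f : ℕ → ℕ be a non-decreasing significantly sublinear function and let 𝒢 be a class of finite graphs closed under taking subgraphs that has f-separators. Let t ≥ 1 be an integer and suppose there exists ε > 0 such that every non-null graph in 𝒢 is ε-resistant to t-percolation. Then there exists δ > 0 such that every graph G ∈ 𝒢 contains at least δ·|V(G)| pairwise disjoint t-islands. -/
open SimpleGraph

/-- The family `P` splits `G[W]` into pairwise disjoint pieces, each with at most `C` vertices
and with no edges of `G` between distinct pieces. -/
def IsFragmentation {V : Type*} (G : SimpleGraph V) (W : Finset V) (C : ℝ)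
    (P : Finset (Finset V)) : Prop :=
  (∀ p ∈ P, p ⊆ W ∧ (p.card : ℝ) ≤ C) ∧
  ∀ p ∈ P, ∀ q ∈ P, p ≠ q → ∀ u ∈ p, ∀ v ∈ q, u ≠ v ∧ ¬ G.Adj u v

/-- The never activated vertices form a `t`-island when there are any. -/
theorem isIsland_inactive {V : Type*} [Finite V] (G : SimpleGraph V) (t : ℕ) (A : Set V)
    (h : ¬ Percolates G t A) : IsIsland G t {v | ¬ PercolationActive G t A v} := by
  classical
  refine ⟨by simpa [Percolates, Set.Nonempty] using h, fun v hv => ?_⟩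
  by_contra! hcard
  have hfin := Set.toFinite (G.neighborSet v \ {v | ¬ PercolationActive G t A v})
  refine hv (.step v hfin.toFinset ?_ ?_ ?_)
  · rwa [← Set.ncard_eq_toFinset_card _ hfin]
  · intro u hu
    exact ((Set.Finite.mem_toFinset _).1 hu).1
  · intro u hu
    exact not_not.1 ((Set.Finite.mem_toFinset _).1 hu).2

/-- Balanced separators of induced subgraphs, expressed inside the ambient graph. -/
theorem HasSeparators.exists_split {f : ℕ → ℕ} {𝒢 : ∀ n : ℕ, SimpleGraph (Fin n) → Prop}
    (hsep : HasSeparators f 𝒢) (hclosed : SubgraphClosed 𝒢) {n : ℕ} {G : SimpleGraph (Fin n)}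
    (hG : 𝒢 n G) (W : Finset (Fin n)) :
    ∃ A B : Finset (Fin n), A ⊆ W ∧ B ⊆ W ∧ Disjoint A B ∧
      (∀ u ∈ A, ∀ v ∈ B, ¬ G.Adj u v) ∧ (W \ (A ∪ B)).card ≤ f W.card ∧
      3 * A.card ≤ 2 * W.card ∧ 3 * B.card ≤ 2 * W.card := by
  classical
  let e : Fin W.card ↪ Fin n := W.equivFin.symm.toEmbedding.trans (Function.Embedding.subtype _)
  have heW : ∀ i, e i ∈ W := fun i => (W.equivFin.symm i).2
  have hsurj : ∀ v ∈ W, ∃ i, e i = v := fun v hv => ⟨W.equivFin ⟨v, hv⟩, by simp [e]⟩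
  obtain ⟨L, R, hLR, ho, hL, hR⟩ := hsep _ (G.comap e)
    (hclosed G _ hG ⟨e, e.injective, fun _ _ h => h⟩)
  have hverts : ∀ i, i ∈ L.verts ∨ i ∈ R.verts := fun i => by
    have : i ∈ (L ⊔ R).verts := by rw [hLR]; trivial
    simpa using this
  have hadj : ∀ i j, G.Adj (e i) (e j) → L.Adj i j ∨ R.Adj i j := fun i j h => by
    have : (L ⊔ R).Adj i j := by rw [hLR]; exact h
    simpa using this
  have hcard : ∀ (s : Set (Fin W.card)) [Fintype s], (s.toFinset.map e).card = s.ncard := fun s _ => by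
    rw [Finset.card_map, Set.ncard_eq_toFinset_card']
  refine ⟨(L.verts \ R.verts).toFinset.map e, (R.verts \ L.verts).toFinset.map e,
    ?_, ?_, ?_, ?_, ?_, by rwa [hcard], by rwa [hcard]⟩
  · intro v hv
    obtain ⟨i, -, rfl⟩ := Finset.mem_map.1 hv
    exact heW i
  · intro v hv
    obtain ⟨i, -, rfl⟩ := Finset.mem_map.1 hv
    exact heW i
  · rw [Finset.disjoint_map, Set.disjoint_toFinset]
    exact disjoint_sdiff_sdiff
  · intro u hu v hv h
    obtain ⟨i, hi, rfl⟩ := Finset.mem_map.1 hu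
    obtain ⟨j, hj, rfl⟩ := Finset.mem_map.1 hv
    rw [Set.mem_toFinset] at hi hj
    rcases hadj i j h with h | h
    · exact hj.2 h.snd_mem
    · exact hi.2 h.fst_mem
  · refine le_trans ?_ ho
    rw [← hcard]
    refine Finset.card_le_card fun v hv => ?_
    rw [Finset.mem_sdiff, Finset.mem_union, not_or] at hv
    obtain ⟨i, rfl⟩ := hsurj v hv.1
    have h1 := hv.2.1
    have h2 := hv.2.2
    simp only [Finset.mem_map', Set.mem_toFinset, Set.mem_sdiff, Set.mem_inter_iff] at h1 h2 ⊢
    have := hverts i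
    tauto

theorem exists_fragmentation_sum {f : ℕ → ℕ} (hmono : Monotone f)
    {𝒢 : ∀ n : ℕ, SimpleGraph (Fin n) → Prop} (hclosed : SubgraphClosed 𝒢)
    (hsep : HasSeparators f 𝒢) {n : ℕ} {G : SimpleGraph (Fin n)} (hG : 𝒢 n G) (i₀ k : ℕ)
    (W : Finset (Fin n)) (hW : (W.card : ℝ) ≤ (3 / 2 : ℝ) ^ (i₀ + k)) :
    ∃ P, IsFragmentation G W ((3 / 2 : ℝ) ^ i₀) P ∧
      ((W \ P.biUnion id).card : ℝ) ≤ W.card * ∑ i ∈ Finset.range k,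
        (f ⌈(3 / 2 : ℝ) ^ (i₀ + i + 1)⌉₊ : ℝ) / (3 / 2 : ℝ) ^ (i₀ + i) := by
  classical
  induction k generalizing W with
  | zero => exact ⟨{W}, by simpa [IsFragmentation] using hW, by simp⟩
  | succ k ih =>
    rw [Finset.sum_range_succ]
    set s := ∑ i ∈ Finset.range k,
        (f ⌈(3 / 2 : ℝ) ^ (i₀ + i + 1)⌉₊ : ℝ) / (3 / 2 : ℝ) ^ (i₀ + i)
    have hs : 0 ≤ s := Finset.sum_nonneg fun i _ => by positivity
    by_cases hsmall : (W.card : ℝ) ≤ (3 / 2 : ℝ) ^ (i₀ + k)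
    · obtain ⟨P, hP, hb⟩ := ih W hsmall
      refine ⟨P, hP, hb.trans ?_⟩
      gcongr
      exact le_add_of_nonneg_right (by positivity)
    obtain ⟨A, B, hAW, hBW, hAB, hadj, ho, hA, hB⟩ := hsep.exists_split hclosed hG W
    have hA' : (3 : ℝ) * A.card ≤ 2 * W.card := by exact_mod_cast hA
    have hB' : (3 : ℝ) * B.card ≤ 2 * W.card := by exact_mod_cast hB
    have hpow : (3 / 2 : ℝ) ^ (i₀ + (k + 1)) = 3 / 2 * (3 / 2 : ℝ) ^ (i₀ + k) := by ring
    obtain ⟨P, hP, hPb⟩ := ih A (by linarith)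
    obtain ⟨Q, hQ, hQb⟩ := ih B (by linarith)
    refine ⟨P ∪ Q, ⟨?_, ?_⟩, ?_⟩
    · intro p hp
      rcases Finset.mem_union.1 hp with hp | hp
      · exact ⟨(hP.1 p hp).1.trans hAW, (hP.1 p hp).2⟩
      · exact ⟨(hQ.1 p hp).1.trans hBW, (hQ.1 p hp).2⟩
    · intro p hp q hq hpq u hu v hv
      rcases Finset.mem_union.1 hp with hp | hp <;> rcases Finset.mem_union.1 hq with hq | hq
      · exact hP.2 p hp q hq hpq u hu v hv
      · have huA := (hP.1 p hp).1 hu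
        have hvB := (hQ.1 q hq).1 hv
        exact ⟨Finset.disjoint_iff_ne.1 hAB u huA v hvB, hadj u huA v hvB⟩
      · have huB := (hQ.1 p hp).1 hu
        have hvA := (hP.1 q hq).1 hv
        exact ⟨(Finset.disjoint_iff_ne.1 hAB v hvA u huB).symm,
          fun h => hadj v hvA u huB h.symm⟩
      · exact hQ.2 p hp q hq hpq u hu v hv
    · have hsub : W \ (P ∪ Q).biUnion id ⊆
          W \ (A ∪ B) ∪ (A \ P.biUnion id ∪ B \ Q.biUnion id) := by
        intro v
        rw [Finset.union_biUnion]
        simp only [Finset.mem_sdiff, Finset.mem_union]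
        tauto
      have h1 : ((W \ (P ∪ Q).biUnion id).card : ℝ) ≤
          (W \ (A ∪ B)).card + ((A \ P.biUnion id).card + (B \ Q.biUnion id).card) := by
        exact_mod_cast (Finset.card_le_card hsub).trans ((Finset.card_union_le _ _).trans
          (Nat.add_le_add_left (Finset.card_union_le _ _) _))
      have h2 : ((A.card : ℝ) + B.card) ≤ W.card := by
        rw [← Nat.cast_add, ← Finset.card_union_of_disjoint hAB]
        exact_mod_cast Finset.card_le_card (Finset.union_subset hAW hBW)
      have h3 : ((W \ (A ∪ B)).card : ℝ) ≤ f ⌈(3 / 2 : ℝ) ^ (i₀ + k + 1)⌉₊ := by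
        refine Nat.cast_le.2 (ho.trans (hmono ?_))
        exact_mod_cast hW.trans (Nat.le_ceil _)
      have h4 : (f ⌈(3 / 2 : ℝ) ^ (i₀ + k + 1)⌉₊ : ℝ) ≤
          W.card * (f ⌈(3 / 2 : ℝ) ^ (i₀ + k + 1)⌉₊ / (3 / 2 : ℝ) ^ (i₀ + k)) := by
        rw [← mul_div_assoc, le_div_iff₀ (by positivity), mul_comm]
        gcongr
        exact (not_le.1 hsmall).le
      nlinarith [mul_le_mul_of_nonneg_right h2 hs]

/-- Classes with significantly sublinear separators are fragmentable. -/
theorem exists_fragmentation {f : ℕ → ℕ} (hmono : Monotone f) (hss : SignificantlySublinear f)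
    {𝒢 : ∀ n : ℕ, SimpleGraph (Fin n) → Prop} (hclosed : SubgraphClosed 𝒢)
    (hsep : HasSeparators f 𝒢) {η : ℝ} (hη : 0 < η) :
    ∃ C : ℝ, 0 < C ∧ ∀ (n : ℕ) (G : SimpleGraph (Fin n)), 𝒢 n G →
      ∃ P, IsFragmentation G Finset.univ C P ∧
        ((Finset.univ \ P.biUnion id).card : ℝ) ≤ η * n := by
  set g : ℕ → ℝ := fun i => (f ⌈(3 / 2 : ℝ) ^ i⌉₊ : ℝ) / (3 / 2 : ℝ) ^ i with hg
  have hgs : Summable g := hss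
  have hg0 : ∀ i, 0 ≤ g i := fun i => by positivity
  obtain ⟨i₀, hi₀⟩ := ((tendsto_sum_nat_add g).eventually
    (gt_mem_nhds (by positivity : 0 < η * (2 / 3)))).exists_forall_of_atTop
  have hi₀ := hi₀ (i₀ + 1) (by omega)
  refine ⟨(3 / 2 : ℝ) ^ i₀, by positivity, fun n G hG => ?_⟩
  obtain ⟨k, hk⟩ := pow_unbounded_of_one_lt (n : ℝ) (by norm_num : (1 : ℝ) < 3 / 2)
  obtain ⟨P, hP, hb⟩ := exists_fragmentation_sum hmono hclosed hsep hG i₀ k Finset.univ (by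
    rw [Finset.card_fin]
    exact hk.le.trans (pow_le_pow_right₀ (by norm_num) (by omega)))
  refine ⟨P, hP, hb.trans ?_⟩
  rw [Finset.card_fin, mul_comm]
  gcongr
  calc _ = 3 / 2 * ∑ i ∈ Finset.range k, g (i + (i₀ + 1)) := by
        rw [Finset.mul_sum]
        refine Finset.sum_congr rfl fun i _ => ?_
        rw [hg, show i + (i₀ + 1) = i₀ + i + 1 by ring]
        simp only [pow_succ _ (i₀ + i)]
        field_simp
    _ ≤ 3 / 2 * ∑' i, g (i + (i₀ + 1)) := by
        gcongr
        exact ((summable_nat_add_iff _).2 hgs).sum_le_tsum _ fun i _ => hg0 _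
    _ ≤ η := by linarith

theorem IsFragmentation.isIsland_inter {V : Type*} [Finite V] {G : SimpleGraph V} {W : Finset V}
    {C : ℝ} {P : Finset (Finset V)} (hP : IsFragmentation G W C P) {t : ℕ} {S : Set V}
    (hS : IsIsland G t S) (hSP : ∀ v ∈ S, ∃ p ∈ P, v ∈ p) :
    ∃ p ∈ P, IsIsland G t (S ∩ p) := by
  obtain ⟨v, hv⟩ := hS.1
  obtain ⟨p, hp, hvp⟩ := hSP v hv
  refine ⟨p, hp, ⟨v, hv, hvp⟩, fun u hu => ?_⟩
  refine (Set.ncard_le_ncard ?_ (Set.toFinite _)).trans_lt (hS.2 u hu.1)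
  rintro w ⟨huw, hw⟩
  refine ⟨huw, fun hwS => hw ⟨hwS, ?_⟩⟩
  obtain ⟨q, hq, hwq⟩ := hSP w hwS
  by_cases hpq : p = q
  · exact hpq ▸ hwq
  · exact absurd huw (hP.2 p hp q hq hpq u hu.2 w hwq).2

/-- if `f` is non-decreasing and significantly sublinear, the
subgraph-closed class `𝒢` has `f`-separators, and every non-null graph in `𝒢` is
`ε`-resistant to `t`-percolation for some `ε > 0`, then for some `δ > 0` every `G ∈ 𝒢`
contains at least `δ|V(G)|` pairwise disjoint `t`-islands. -/
theorem stmt18 (f : ℕ → ℕ) (hmono : Monotone f) (hss : SignificantlySublinear f)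
    (𝒢 : ∀ n : ℕ, SimpleGraph (Fin n) → Prop) (hclosed : SubgraphClosed 𝒢)
    (hsep : HasSeparators f 𝒢) (t : ℕ) (ht : 1 ≤ t)
    (hres : ∃ ε : ℝ, 0 < ε ∧ ∀ (n : ℕ) (G : SimpleGraph (Fin n)), 𝒢 n G → 0 < n →
      ∀ A : Set (Fin n), (A.ncard : ℝ) ≤ ε * n → ¬ Percolates G t A) :
    ∃ δ : ℝ, 0 < δ ∧ ∀ (n : ℕ) (G : SimpleGraph (Fin n)), 𝒢 n G →
      ∃ k : ℕ, δ * n ≤ (k : ℝ) ∧ HasDisjointIslands G t k := by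
  classical
  obtain ⟨ε, hε, hres⟩ := hres
  obtain ⟨C, hC, hfrag⟩ := exists_fragmentation hmono hss hclosed hsep (half_pos hε)
  refine ⟨ε / 2 / C, by positivity, fun n G hG => ?_⟩
  obtain ⟨P, hP, hX⟩ := hfrag n G hG
  let Q : Finset (Finset (Fin n)) :=
    P.filter fun p => ∃ S : Set (Fin n), S ⊆ (p : Set (Fin n)) ∧ IsIsland G t S
  have hQS : ∀ p ∈ Q, ∃ S : Set (Fin n), S ⊆ (p : Set (Fin n)) ∧ IsIsland G t S :=
    fun p hp => (Finset.mem_filter.1 hp).2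
  choose! S hSp hS using hQS
  refine ⟨Q.card, ?_, fun i => S (Q.equivFin.symm i), fun i => hS _ (Q.equivFin.symm i).2, ?_⟩
  · rcases Nat.eq_zero_or_pos n with rfl | hn
    · simp
    set A : Finset (Fin n) := (Finset.univ \ P.biUnion id) ∪ Q.biUnion id with hA
    have hnot : (n : ℝ) * ε < A.card := by
      by_contra! hcard
      have hI := isIsland_inactive G t (A : Set (Fin n))
        (hres n G hG hn A (by rw [Set.ncard_coe_finset]; linarith))
      have hmem : ∀ v, ¬ PercolationActive G t A v → v ∉ A := fun v hv h => hv (.base v h)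
      obtain ⟨p, hp, hpI⟩ := hP.isIsland_inter hI fun v hv => by
        have := hmem v hv
        simp only [hA, Finset.mem_union, Finset.mem_sdiff, Finset.mem_univ, true_and,
          not_or, not_not, Finset.mem_biUnion, id] at this
        exact this.1
      obtain ⟨v, hv, hvp⟩ := hpI.1
      refine hmem v hv (Finset.mem_union_right _ (Finset.mem_biUnion.2 ⟨p, ?_, hvp⟩))
      exact Finset.mem_filter.2 ⟨hp, _, Set.inter_subset_right, hpI⟩
    have hQC : ((Q.biUnion id).card : ℝ) ≤ Q.card * C := by
      calc ((Q.biUnion id).card : ℝ) ≤ ∑ p ∈ Q, (p.card : ℝ) := by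
            exact_mod_cast Finset.card_biUnion_le
        _ ≤ Q.card * C := by
            rw [← nsmul_eq_mul]
            exact Finset.sum_le_card_nsmul _ _ _ fun p hp =>
              (hP.1 p (Finset.mem_filter.1 hp).1).2
    have hAcard : (A.card : ℝ) ≤
        (Finset.univ \ P.biUnion id).card + (Q.biUnion id).card := by
      exact_mod_cast Finset.card_union_le _ _
    rw [div_mul_eq_mul_div, div_le_iff₀ hC]
    linarith
  · intro i j hij
    have hmemP : ∀ i, (Q.equivFin.symm i : Finset (Fin n)) ∈ P :=
      fun i => (Finset.mem_filter.1 (Q.equivFin.symm i).2).1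
    refine Set.disjoint_left.2 fun v hvi hvj => ?_
    refine (hP.2 _ (hmemP i) _ (hmemP j) ?_ v (hSp _ (Q.equivFin.symm i).2 hvi) v
      (hSp _ (Q.equivFin.symm j).2 hvj)).1 rfl
    exact fun h => hij (Q.equivFin.symm.injective (Subtype.ext h))
end
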